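/- Let M = p²q²r² with p < q < r primes, and let A, B ⊆ ℤ_M satisfy A ⊕ B = ℤ_M, |A| = |B| = pqr, 0 ∈ A ∩ B, neither contained in a proper subgroup, and 1 ∉ Div(B). Then p, q, r ∈ Div(B) and p², q², r² ∉ Div(B). -/

import Mathlib

open Finset

/-- `A ⊕ B = ℤ_M`: unique representation of every element as `a + b`. -/
def Tiles {M : ℕ} (A B : Finset (ZMod M)) : Prop :=
  ∀ g : ZMod M, ∃! ab : ZMod M × ZMod M, ab.1 ∈ A ∧ ab.2 ∈ B ∧ ab.1 + ab.2 = g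

/-- The division set `Div(E) = {gcd(a - a', M) : a, a' ∈ E}`. -/
def DivSet {M : ℕ} (E : Finset (ZMod M)) : Set ℕ :=
  {d | ∃ a ∈ E, ∃ b ∈ E, Nat.gcd ((a - b).val) M = d}

/-- `E` is not contained in any proper subgroup `dℤ_M` (`d ∣ M`, `d > 1`). -/
def NotInProperSubgroup {M : ℕ} (E : Finset (ZMod M)) : Prop :=
  ∀ d : ℕ, d ∣ M → 1 < d → ∃ x ∈ E, ¬ d ∣ x.val

set_option linter.unusedSectionVars false
set_option linter.unusedVariables false
set_option linter.unusedSimpArgs false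


/-- reduction `ℤ/p² → ℤ/p`. -/
def redp (p : ℕ) : ZMod (p ^ 2) →+* ZMod p :=
  ZMod.castHom (dvd_pow_self p two_ne_zero) (ZMod p)

/-- the embedding `t ↦ p t` of `ℤ/p` into `ℤ/p²`. -/
def embp (p : ℕ) (t : ZMod p) : ZMod (p ^ 2) := (p : ZMod (p ^ 2)) * (t.val : ZMod (p ^ 2))

section one
variable {p : ℕ} [hp : Fact p.Prime]

lemma redp_surj (x : ZMod p) : ∃ y : ZMod (p ^ 2), redp p y = x :=
  ZMod.castHom_surjective _ x

lemma pp_zero : (p : ZMod (p ^ 2)) * (p : ZMod (p ^ 2)) = 0 := by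
  have : ((p ^ 2 : ℕ) : ZMod (p ^ 2)) = 0 := ZMod.natCast_self _
  rw [← this]; push_cast; ring

lemma redp_natCast (n : ℕ) : redp p (n : ZMod (p ^ 2)) = n := map_natCast _ _

lemma embp_natCast (n : ℕ) : embp p (n : ZMod p) = (p : ZMod (p ^ 2)) * n := by
  unfold embp
  rw [ZMod.val_natCast]
  conv_rhs => rw [← Nat.mod_add_div n p]
  push_cast
  rw [mul_add, ← mul_assoc, pp_zero, zero_mul, add_zero]

lemma embp_redp (x : ZMod (p ^ 2)) : embp p (redp p x) = (p : ZMod (p ^ 2)) * x := by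
  obtain ⟨n, rfl⟩ := ZMod.natCast_zmod_surjective x
  rw [redp_natCast, embp_natCast]

lemma embp_add (s t : ZMod p) : embp p (s + t) = embp p s + embp p t := by
  obtain ⟨a, rfl⟩ := redp_surj s
  obtain ⟨b, rfl⟩ := redp_surj t
  rw [← map_add, embp_redp, embp_redp, embp_redp, mul_add]

lemma embp_mul (s : ZMod (p ^ 2)) (t : ZMod p) : embp p (redp p s * t) = s * embp p t := by
  obtain ⟨b, rfl⟩ := redp_surj t
  rw [← map_mul, embp_redp, embp_redp]; ring

lemma redp_embp (t : ZMod p) : redp p (embp p t) = 0 := by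
  unfold embp; rw [map_mul, redp_natCast]; simp

lemma redp_eq_zero_iff (x : ZMod (p ^ 2)) : redp p x = 0 ↔ ∃ t, x = embp p t := by
  constructor
  · intro h
    obtain ⟨n, rfl⟩ := ZMod.natCast_zmod_surjective x
    rw [redp_natCast, ZMod.natCast_eq_zero_iff] at h
    obtain ⟨k, rfl⟩ := h
    exact ⟨k, by rw [embp_natCast]; push_cast; ring⟩
  · rintro ⟨t, rfl⟩; exact redp_embp t

lemma embp_inj : Function.Injective (embp p) := by
  intro s t h
  obtain ⟨a, rfl⟩ := redp_surj s
  obtain ⟨b, rfl⟩ := redp_surj t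
  rw [embp_redp, embp_redp] at h
  obtain ⟨n, rfl⟩ := ZMod.natCast_zmod_surjective a
  obtain ⟨m, rfl⟩ := ZMod.natCast_zmod_surjective b
  rw [redp_natCast, redp_natCast, ZMod.natCast_eq_natCast_iff]
  rw [← Nat.cast_mul, ← Nat.cast_mul, ZMod.natCast_eq_natCast_iff, pow_two] at h
  exact Nat.ModEq.mul_left_cancel' hp.out.ne_zero h

lemma embp_sub (s t : ZMod p) : embp p (s - t) = embp p s - embp p t := by
  rw [eq_sub_iff_add_eq, ← embp_add, sub_add_cancel]

lemma embp_zero : embp p 0 = 0 := by simp [embp]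

lemma isUnit_iff_redp (x : ZMod (p ^ 2)) : IsUnit x ↔ redp p x ≠ 0 := by
  constructor
  · intro h; exact (h.map (redp p)).ne_zero
  · intro h
    obtain ⟨n, rfl⟩ := ZMod.natCast_zmod_surjective x
    rw [redp_natCast, Ne, ZMod.natCast_eq_zero_iff] at h
    rw [ZMod.isUnit_iff_coprime]
    exact Nat.Coprime.pow_right _ ((Nat.Prime.coprime_iff_not_dvd hp.out).2 h).symm

/-- sums over lines of `(ℤ/p)²`. -/
lemma lines_lemma (K : ZMod p → ZMod p → ℤ) (C : ℤ)
    (h : ∀ u τ, τ ≠ 0 → ∑ x, K (u - τ * x) x = C) (u x : ZMod p) :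
    (p : ℤ) ^ 2 * K u x - p * ∑ u', K u' x - p * ∑ x', K u x' + ∑ x', ∑ u', K u' x' = 0 := by
  classical
  have hcard : (Fintype.card (ZMod p) : ℤ) = p := by rw [ZMod.card]
  -- total sum
  have h1 : ∑ x', ∑ u', K u' x' = p * C := by
    have : ∑ u, ∑ x, K (u - 1 * x) x = p * C := by
      rw [Finset.sum_congr rfl (fun u _ => h u 1 one_ne_zero)]
      simp [hcard]
    rw [← this]
    conv_rhs => rw [Finset.sum_comm]
    refine Finset.sum_congr rfl fun x' _ => ?_
    exact (Equiv.sum_comp (Equiv.subRight (1 * x')) (fun u => K u x')).symm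
  have h2 : ∑ τ ∈ univ.erase (0 : ZMod p), ∑ x', K (u - τ * (x' - x)) x' = (p - 1) * C := by
    have e : ∀ τ ∈ univ.erase (0 : ZMod p), ∑ x', K (u - τ * (x' - x)) x' = C := by
      intro τ hτ
      rw [← h (u + τ * x) τ (Finset.ne_of_mem_erase hτ)]
      refine Finset.sum_congr rfl fun x' _ => ?_
      congr 1; ring
    rw [Finset.sum_congr rfl e, Finset.sum_const, Finset.card_erase_of_mem (mem_univ _),
      Finset.card_univ, ZMod.card, nsmul_eq_mul, Nat.cast_sub hp.out.one_le]
    simp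
  rw [Finset.sum_comm] at h2
  have h3 : ∀ x', ∑ τ ∈ univ.erase (0 : ZMod p), K (u - τ * (x' - x)) x' =
      (∑ u', K u' x' - K u x') + if x' = x then (p * K u x - ∑ u', K u' x) else 0 := by
    intro x'
    split_ifs with hx
    · subst hx
      simp only [sub_self, mul_zero, sub_zero, Finset.sum_const,
        Finset.card_erase_of_mem (mem_univ _), Finset.card_univ, ZMod.card, nsmul_eq_mul,
        Nat.cast_sub hp.out.one_le]
      push_cast; ring
    · have hx' : x' - x ≠ 0 := sub_ne_zero.2 hx
      have : ∑ τ, K (u - τ * (x' - x)) x' = ∑ u', K u' x' := by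
        have hb : Function.Bijective (fun τ : ZMod p => u - τ * (x' - x)) := by
          refine (Finite.injective_iff_bijective).1 ?_
          intro a b hab
          have : a * (x' - x) = b * (x' - x) := by simpa using hab
          exact mul_right_cancel₀ hx' this
        exact hb.sum_comp (fun u' => K u' x')
      rw [← this, ← Finset.sum_erase_add _ _ (mem_univ (0 : ZMod p))]
      simp
  rw [Finset.sum_congr rfl (fun x' _ => h3 x'), Finset.sum_add_distrib, Finset.sum_sub_distrib] at h2
  simp only [Finset.sum_ite_eq', mem_univ, if_true] at h2
  have hC : (p : ℤ) * (p - 1) * C = (p - 1) * ∑ x', ∑ u', K u' x' := by rw [h1]; ring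
  linear_combination (p : ℤ) * h2 + hC

lemma conv_lemma (f g : ZMod p → ℤ)
    (h : ∀ τ, τ ≠ 0 → ∀ u u', ∑ x, f (u - τ * x) * g x = ∑ x, f (u' - τ * x) * g x) :
    (∀ u u', f u = f u') ∨ (∀ u u', g u = g u') := by
  have hp0 : (p : ℤ) ≠ 0 := by exact_mod_cast hp.out.ne_zero
  have key : ∀ u τ, τ ≠ 0 → ∑ x, (p * (f (u - τ * x) * g x)) = (∑ u, f u) * ∑ x, g x := by
    intro u τ hτ
    rw [← Finset.mul_sum]
    have : ∑ u', ∑ x, f (u' - τ * x) * g x = p * ∑ x, f (u - τ * x) * g x := by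
      rw [Finset.sum_congr rfl (fun u' _ => h τ hτ u' u)]
      simp [ZMod.card]
    rw [← this, Finset.sum_comm, Finset.mul_sum]
    refine Finset.sum_congr rfl fun x' _ => ?_
    rw [← Finset.sum_mul]
    congr 1
    exact Equiv.sum_comp (Equiv.subRight (τ * x')) (fun u => f u)
  have := fun u x => lines_lemma (fun u x => (p : ℤ) * (f u * g x)) _ key u x
  have h2 : ∀ u x, (p * f u - ∑ u', f u') * (p * g x - ∑ x', g x') = 0 := by
    intro u x
    have h3 := this u x
    simp only [← Finset.mul_sum, ← Finset.sum_mul] at h3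
    have : (p : ℤ) * ((p * f u - ∑ u', f u') * (p * g x - ∑ x', g x')) = 0 := by
      linear_combination h3
    exact (mul_eq_zero.1 this).resolve_left hp0
  by_cases hf : ∃ u, p * f u - ∑ u', f u' ≠ 0
  · right
    obtain ⟨u, hu⟩ := hf
    intro x x'
    have a := (mul_eq_zero.1 (h2 u x)).resolve_left hu
    have b := (mul_eq_zero.1 (h2 u x')).resolve_left hu
    have : (p : ℤ) * g x = p * g x' := by linear_combination a - b
    exact mul_left_cancel₀ hp0 this
  · left
    push Not at hf
    intro x x'
    have : (p : ℤ) * f x = p * f x' := by linear_combination hf x - hf x'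
    exact mul_left_cancel₀ hp0 this
end one


/-- the group `∏ ℤ/pᵢ²`. -/
abbrev GG (p : Fin 3 → ℕ) := ∀ i, ZMod (p i ^ 2)
/-- the group of classes `∏ ℤ/pᵢ`. -/
abbrev CC (p : Fin 3 → ℕ) := ∀ i, ZMod (p i)

section two
variable {p : Fin 3 → ℕ} 

/-- class of an element. -/
def cl (g : GG p) : CC p := fun i => redp (p i) (g i)

variable [hp : ∀ i, Fact (p i).Prime]

/-- kernel element. -/
def kr (t : CC p) : GG p := fun i => embp (p i) (t i)

lemma cl_add (g h : GG p) : cl (g + h) = cl g + cl h := by funext i; simp [cl]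
lemma cl_sub (g h : GG p) : cl (g - h) = cl g - cl h := by funext i; simp [cl]
lemma cl_mul (g h : GG p) : cl (g * h) = cl g * cl h := by funext i; simp [cl]

lemma cl_surj (v : CC p) : ∃ g : GG p, cl g = v := by
  choose g hg using fun i => redp_surj (v i)
  exact ⟨g, funext hg⟩

lemma cl_kr (t : CC p) : cl (kr t) = 0 := by funext i; exact redp_embp _

lemma isUnit_iff_cl (u : GG p) : IsUnit u ↔ ∀ i, cl u i ≠ 0 := by
  rw [Pi.isUnit_iff]
  exact forall_congr' fun i => isUnit_iff_redp _

lemma kr_inj : Function.Injective (kr (p := p)) := by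
  intro s t h
  funext i
  exact embp_inj (congrFun h i)

lemma cl_eq_iff (g h : GG p) : cl g = cl h ↔ ∃ t, g = h + kr t := by
  constructor
  · intro e
    have : ∀ i, ∃ t, (g - h) i = embp (p i) t := by
      intro i
      rw [← redp_eq_zero_iff]
      have := congrFun (cl_sub g h) i
      rw [e, sub_self] at this
      exact this
    choose t ht using this
    refine ⟨t, ?_⟩
    funext i
    have := ht i
    simp only [Pi.sub_apply] at this
    simp only [Pi.add_apply, kr, ← this]; ring
  · rintro ⟨t, rfl⟩
    rw [cl_add, cl_kr, add_zero]

lemma cl_eq_at (g h : GG p) (i : Fin 3) : cl g i = cl h i ↔ ∃ t, g i = h i + embp (p i) t := by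
  unfold cl
  rw [← sub_eq_zero, ← map_sub, redp_eq_zero_iff]
  refine exists_congr fun t => ?_
  rw [sub_eq_iff_eq_add']

def NN (p : Fin 3 → ℕ) : ℕ := ∏ i, p i

lemma card_CC : Fintype.card (CC p) = NN p := by
  rw [Fintype.card_pi]; simp [NN, ZMod.card]

lemma fin3 {i j k : Fin 3} (hij : i ≠ j) (hik : i ≠ k) (hjk : j ≠ k) (m : Fin 3) :
    m = i ∨ m = j ∨ m = k := by
  omega

lemma NN_eq {i j k : Fin 3} (hij : i ≠ j) (hik : i ≠ k) (hjk : j ≠ k) :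
    NN p = p i * p j * p k := by
  unfold NN
  have : (univ : Finset (Fin 3)) = {i, j, k} := by
    ext m; simpa using fin3 hij hik hjk m
  rw [this, Finset.prod_insert (by simp [hij, hik]), Finset.prod_insert (by simp [hjk]),
    Finset.prod_singleton, mul_assoc]

lemma card_fiber (β : CC p) : (univ.filter fun g : GG p => cl g = β).card = NN p := by
  obtain ⟨g0, rfl⟩ := cl_surj β
  rw [← card_CC, ← Finset.card_univ]
  symm
  refine Finset.card_bij (fun t _ => g0 + kr t) ?_ ?_ ?_
  · intro t _; simp [cl_add, cl_kr]
  · intro s _ t _ h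
    exact kr_inj (add_left_cancel h)
  · intro g hg
    obtain ⟨t, ht⟩ := (cl_eq_iff _ _).1 (mem_filter.1 hg).2
    exact ⟨t, mem_univ _, ht.symm⟩

/-- unit-multiplier tiling -/
def UT (A B : Finset (GG p)) : Prop :=
  ∀ u : GG p, IsUnit u → (∀ g, ∃ a ∈ A, ∃ b ∈ B, a + u * b = g) ∧
    (∀ a ∈ A, ∀ a' ∈ A, ∀ b ∈ B, ∀ b' ∈ B, a + u * b = a' + u * b' → a = a' ∧ b = b')

def mulS (u : GG p) (B : Finset (GG p)) : Finset (GG p) := B.image (fun b => u * b)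
/-- translate a set. -/
def trS (c : GG p) (B : Finset (GG p)) : Finset (GG p) := B.image (fun b => b - c)

lemma mem_mulS {u : GG p} {B : Finset (GG p)} {x} : x ∈ mulS u B ↔ ∃ b ∈ B, u * b = x := by
  simp [mulS]
lemma mem_trS {u : GG p} {B : Finset (GG p)} {x} : x ∈ trS u B ↔ ∃ b ∈ B, b - u = x := by
  simp [trS]

lemma card_mulS {u : GG p} (hu : IsUnit u) (B : Finset (GG p)) : (mulS u B).card = B.card :=
  Finset.card_image_of_injective _ fun _ _ h => hu.mul_left_cancel h
lemma card_trS (u : GG p) (B : Finset (GG p)) : (trS u B).card = B.card :=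
  Finset.card_image_of_injective _ fun _ _ h => sub_left_injective h

lemma UT.mul {A B : Finset (GG p)} (h : UT A B) {v : GG p} (hv : IsUnit v) : UT A (mulS v B) := by
  intro u hu
  obtain ⟨h1, h2⟩ := h (u * v) (hu.mul hv)
  constructor
  · intro g
    obtain ⟨a, ha, b, hb, e⟩ := h1 g
    exact ⟨a, ha, v * b, mem_mulS.2 ⟨b, hb, rfl⟩, by rw [← e, mul_assoc]⟩
  · intro a ha a' ha' b hb b' hb' e
    obtain ⟨c, hc, rfl⟩ := mem_mulS.1 hb
    obtain ⟨c', hc', rfl⟩ := mem_mulS.1 hb'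
    obtain ⟨r1, r2⟩ := h2 a ha a' ha' c hc c' hc' (by rw [mul_assoc, mul_assoc, e])
    exact ⟨r1, by rw [r2]⟩

lemma UT.tr {A B : Finset (GG p)} (h : UT A B) (v : GG p) : UT A (trS v B) := by
  intro u hu
  obtain ⟨h1, h2⟩ := h u hu
  constructor
  · intro g
    obtain ⟨a, ha, b, hb, e⟩ := h1 (g + u * v)
    exact ⟨a, ha, b - v, mem_trS.2 ⟨b, hb, rfl⟩, by rw [mul_sub]; linear_combination e⟩
  · intro a ha a' ha' b hb b' hb' e
    obtain ⟨c, hc, rfl⟩ := mem_trS.1 hb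
    obtain ⟨c', hc', rfl⟩ := mem_trS.1 hb'
    obtain ⟨r1, r2⟩ := h2 a ha a' ha' c hc c' hc' (by linear_combination e)
    exact ⟨r1, by rw [r2]⟩

/-- the basic rigidity statement -/
lemma UT.key {A B : Finset (GG p)} (h : UT A B) {a a' b b' : GG p} (ha : a ∈ A) (ha' : a' ∈ A)
    (hb : b ∈ B) (hb' : b' ∈ B)
    (hm : ∀ m, (a + b) m = (a' + b') m ∨ (cl a m ≠ cl a' m ∧ cl b m ≠ cl b' m)) :
    a = a' ∧ b = b' := by
  have : ∀ m, ∃ v : ZMod (p m ^ 2), IsUnit v ∧ a m + v * b m = a' m + v * b' m := by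
    intro m
    rcases hm m with h1 | ⟨h1, h2⟩
    · exact ⟨1, isUnit_one, by simpa using h1⟩
    · have e1 : IsUnit (a m - a' m) := by
        rw [isUnit_iff_redp, map_sub]; exact sub_ne_zero.2 h1
      have e2 : IsUnit (b' m - b m) := by
        rw [isUnit_iff_redp, map_sub]; exact sub_ne_zero.2 (Ne.symm h2)
      obtain ⟨w, hw⟩ := e2
      refine ⟨(a m - a' m) * (↑w⁻¹ : ZMod (p m ^ 2)), e1.mul (Units.isUnit _), ?_⟩
      have : (↑w⁻¹ : ZMod (p m ^ 2)) * (b' m - b m) = 1 := by rw [← hw]; simp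
      linear_combination - (a m - a' m) * this
  choose v hv e using this
  exact (h v ((Pi.isUnit_iff).2 hv)).2 a ha a' ha' b hb b' hb' (funext e)

lemma exists_unit (v : CC p) (hv : ∀ i, v i ≠ 0) : ∃ u : GG p, IsUnit u ∧ cl u = v := by
  obtain ⟨u, rfl⟩ := cl_surj v
  exact ⟨u, (isUnit_iff_cl u).2 hv, rfl⟩

/-- decomposition function -/
lemma UT.dec {A B : Finset (GG p)} (h : UT A B) : ∃ f : GG p → GG p,
    (∀ g, f g ∈ B) ∧ (∀ g, g - f g ∈ A) ∧ (∀ a ∈ A, ∀ b ∈ B, f (a + b) = b) ∧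
    (∀ g g', cl g = cl g' → g ≠ g' → ∃ m, g m ≠ g' m ∧ cl (f g) m = cl (f g') m) := by
  obtain ⟨h1, h2⟩ := h 1 isUnit_one
  choose a ha f hf e using h1
  simp only [one_mul] at e h2
  refine ⟨f, hf, fun g => ?_, ?_, ?_⟩
  · have := e g
    rw [← eq_sub_iff_add_eq] at this
    rw [← this]; exact ha g
  · intro a' ha' b hb
    exact (h2 _ (ha _) a' ha' _ (hf _) _ hb (e _)).2
  · intro g g' hc hne
    by_contra hcon
    push Not at hcon
    have := h.key (ha g) (ha g') (hf g) (hf g') (fun m => by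
      rw [e, e]
      by_cases hm : g m = g' m
      · exact Or.inl hm
      · right
        refine ⟨fun hh => hcon m hm ?_, hcon m hm⟩
        have q := congrFun hc m
        rw [← e g, ← e g', cl_add, cl_add] at q
        simp only [Pi.add_apply, hh] at q
        exact add_left_cancel q)
    apply hne
    rw [← e g, ← e g', this.1, this.2]

/-- counting -/
lemma UT.count {A B : Finset (GG p)} (h : UT A B) (Q : GG p → Prop) [DecidablePred Q]
    (P : GG p → Prop) [DecidablePred P] (f : GG p → GG p) (hfB : ∀ g, f g ∈ B)
    (hfA : ∀ g, g - f g ∈ A) (hf : ∀ a ∈ A, ∀ b ∈ B, f (a + b) = b) :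
    (univ.filter fun g => Q g ∧ P (f g)).card =
      ∑ b ∈ B, if P b then (A.filter fun a => Q (a + b)).card else 0 := by
  classical
  rw [Finset.card_eq_sum_card_fiberwise (f := f) (t := B) (fun g _ => hfB g)]
  refine Finset.sum_congr rfl fun b hb => ?_
  split_ifs with hP
  · symm
    refine Finset.card_bij (fun a _ => a + b) ?_ ?_ ?_
    · intro a ha
      have := mem_filter.1 ha
      have e := hf a this.1 b hb
      simp only [mem_filter, mem_univ, true_and]
      rw [e]
      exact ⟨⟨this.2, hP⟩, rfl⟩
    · intro a _ a' _ e; exact add_right_cancel e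
    · intro g hg
      simp only [mem_filter, mem_univ, true_and] at hg
      refine ⟨g - b, ?_, sub_add_cancel _ _⟩
      rw [mem_filter, sub_add_cancel]
      refine ⟨?_, hg.1.1⟩
      rw [← hg.2]; exact hfA g
  · rw [Finset.card_eq_zero, Finset.filter_eq_empty_iff]
    intro g hg e
    apply hP
    rw [← e]
    exact (mem_filter.1 hg).2.2

lemma UT.count' {A B : Finset (GG p)} (h : UT A B) (Q : GG p → Prop) [DecidablePred Q] :
    (univ.filter Q).card = ∑ b ∈ B, (A.filter fun a => Q (a + b)).card := by
  obtain ⟨f, h1, h2, h3, _⟩ := h.dec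
  have := h.count Q (fun _ => True) f h1 h2 h3
  simpa using this

/-- class weights -/
def wt (A : Finset (GG p)) (β : CC p) : ℕ := (A.filter fun a => cl a = β).card

lemma UT.cf {A B : Finset (GG p)} (h : UT A B) (β : CC p) : ∑ b ∈ B, wt A (β - cl b) = NN p := by
  rw [← card_fiber β, h.count']
  refine Finset.sum_congr rfl fun b _ => ?_
  unfold wt
  congr 1
  refine Finset.filter_congr fun a _ => ?_
  rw [cl_add, eq_sub_iff_add_eq]

lemma wt_pos {A : Finset (GG p)} {β : CC p} : wt A β ≠ 0 ↔ ∃ a ∈ A, cl a = β := by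
  unfold wt
  rw [Finset.card_ne_zero]
  constructor
  · rintro ⟨a, ha⟩; exact ⟨a, (mem_filter.1 ha).1, (mem_filter.1 ha).2⟩
  · rintro ⟨a, ha, h⟩; exact ⟨a, mem_filter.2 ⟨ha, h⟩⟩

lemma sum_wt (A : Finset (GG p)) : ∑ β, wt A β = A.card := by
  symm
  exact Finset.card_eq_sum_card_fiberwise (f := cl) (t := univ) (fun g _ => by simp)
end two


section three
variable {p : Fin 3 → ℕ} [hp : ∀ i, Fact (p i).Prime]

/-- move in one coordinate -/
def mv (i : Fin 3) (t : ZMod (p i)) : GG p := Pi.single i (embp (p i) t)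

lemma cl_mv (i : Fin 3) (t : ZMod (p i)) : cl (mv (p := p) i t) = 0 := by
  funext m
  unfold cl mv
  by_cases h : m = i
  · subst h; simp [redp_embp]
  · simp [h]

lemma mv_add (i : Fin 3) (s t : ZMod (p i)) : mv (p := p) i (s + t) = mv i s + mv i t := by
  unfold mv; rw [embp_add, Pi.single_add]

lemma dvd_card_of_inv (i : Fin 3) (C : Finset (GG p)) (h : ∀ g ∈ C, ∀ t, g + mv i t ∈ C) :
    p i ∣ C.card := by
  classical
  let f : Function.End C := fun g => ⟨g.1 + mv i 1, h _ g.2 _⟩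
  have hf : ∀ n : ℕ, ∀ g : C, ((f ^ n) g).1 = g.1 + mv i (n : ZMod (p i)) := by
    intro n
    induction n with
    | zero => intro g; show g.1 = _; simp [mv, embp_zero]
    | succ n ih =>
      intro g
      rw [pow_succ]
      show ((f ^ n) (f g)).1 = _
      rw [ih]
      show g.1 + mv i 1 + mv i n = _
      rw [add_assoc, ← mv_add]; push_cast; rw [add_comm (1 : ZMod (p i))]
  have h1 : f ^ (p i) ^ 1 = 1 := by
    funext g
    apply Subtype.ext
    rw [pow_one, hf]; show _ = g.1; simp [mv, embp_zero]
  have := Equiv.Perm.card_fixedPoints_modEq h1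
  have h2 : IsEmpty (Function.fixedPoints f) := by
    constructor
    rintro ⟨g, hg⟩
    have e : g.1 + mv i 1 = g.1 := congrArg Subtype.val hg
    have e2 : (mv i 1 : GG p) i = 0 := by
      have : (mv i 1 : GG p) = 0 := by simpa using e
      rw [this]; rfl
    simp only [mv, Pi.single_eq_same] at e2
    have : (1 : ZMod (p i)) = 0 := embp_inj (by rw [e2, embp_zero])
    exact one_ne_zero this
  rw [Fintype.card_of_isEmpty (α := Function.fixedPoints f)] at this
  have := (Nat.modEq_zero_iff_dvd).1 this
  simpa using this

/-- consequences of rigidity for the decomposition function: one move -/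
lemma one_mv {f : GG p → GG p}
    (h4 : ∀ g g', cl g = cl g' → g ≠ g' → ∃ m, g m ≠ g' m ∧ cl (f g) m = cl (f g') m)
    {g g' : GG p} (hc : cl g = cl g') (i : Fin 3) (h : ∀ m, m ≠ i → g m = g' m) :
    cl (f g) i = cl (f g') i := by
  by_cases e : g = g'
  · rw [e]
  · obtain ⟨m, hm, h'⟩ := h4 g g' hc e
    by_cases hmi : m = i
    · rw [← hmi]; exact h'
    · exact absurd (h m hmi) hm

lemma two_mv {f : GG p → GG p}
    (h4 : ∀ g g', cl g = cl g' → g ≠ g' → ∃ m, g m ≠ g' m ∧ cl (f g) m = cl (f g') m)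
    {g g' : GG p} (hc : cl g = cl g') {i j k : Fin 3} (hij : i ≠ j) (hik : i ≠ k) (hjk : j ≠ k)
    (h : g i = g' i) :
    cl (f g) j = cl (f g') j ∨ cl (f g) k = cl (f g') k := by
  by_cases e : g = g'
  · rw [e]; simp
  · obtain ⟨m, hm, h'⟩ := h4 g g' hc e
    rcases fin3 hij hik hjk m with rfl | rfl | rfl
    · exact absurd h hm
    · exact Or.inl h'
    · exact Or.inr h'

def mix (i j k : Fin 3) (a b c : GG p) : GG p := fun m => if m = i then a m else if m = j then b m else c m

lemma mix_i {i j k : Fin 3} (a b c : GG p) : mix i j k a b c i = a i := by simp [mix]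
lemma mix_j {i j k : Fin 3} (hij : i ≠ j) (a b c : GG p) : mix i j k a b c j = b j := by
  simp [mix, hij.symm]
lemma mix_k {i j k : Fin 3} (hik : i ≠ k) (hjk : j ≠ k) (a b c : GG p) : mix i j k a b c k = c k := by
  simp [mix, hik.symm, hjk.symm]

lemma cl_mix {i j k : Fin 3} {a b c : GG p} {β : CC p} (ha : cl a = β) (hb : cl b = β)
    (hc : cl c = β) : cl (mix i j k a b c) = β := by
  funext m
  have : cl (mix i j k a b c) m = redp (p m) (mix i j k a b c m) := rfl
  rw [this]
  unfold mix
  split_ifs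
  · exact congrFun ha m
  · exact congrFun hb m
  · exact congrFun hc m

/-- four classes forming a tetrahedron -/
structure Tet (i j k : Fin 3) (s0 s1 s2 s3 : CC p) : Prop where
  ij : i ≠ j
  ik : i ≠ k
  jk : j ≠ k
  i1 : s1 i = s0 i
  i2 : s3 i = s2 i
  i3 : s2 i ≠ s0 i
  j1 : s2 j = s0 j
  j2 : s3 j = s1 j
  j3 : s1 j ≠ s0 j
  k1 : s3 k = s0 k
  k2 : s2 k = s1 k
  k3 : s1 k ≠ s0 k

lemma Tet.swjk {i j k : Fin 3} {s0 s1 s2 s3 : CC p} (h : Tet i j k s0 s1 s2 s3) :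
    Tet i k j s0 s1 s3 s2 := by
  obtain ⟨a1, a2, a3, b1, b2, b3, c1, c2, c3, d1, d2, d3⟩ := h
  exact ⟨a2, a1, a3.symm, b1, b2.symm, b2 ▸ b3, d1, d2, d3, c1, c2, c3⟩

lemma Tet.swij {i j k : Fin 3} {s0 s1 s2 s3 : CC p} (h : Tet i j k s0 s1 s2 s3) :
    Tet j i k s0 s2 s1 s3 := by
  obtain ⟨a1, a2, a3, b1, b2, b3, c1, c2, c3, d1, d2, d3⟩ := h
  exact ⟨a1.symm, a3, a2, c1, c2, c3, b1, b2, b3, d1, d2.symm, d2 ▸ d3⟩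

lemma Tet.cen {i j k : Fin 3} {s0 s1 s2 s3 : CC p} (h : Tet i j k s0 s1 s2 s3) :
    Tet i j k s1 s0 s3 s2 := by
  obtain ⟨a1, a2, a3, b1, b2, b3, c1, c2, c3, d1, d2, d3⟩ := h
  exact ⟨a1, a2, a3, b1.symm, b2.symm, by rw [b2, b1]; exact b3, c2, c1, c3.symm, d2, d1, d3.symm⟩

lemma Tet.noTriple {A B : Finset (GG p)} (hU : UT A B) {i j k : Fin 3} {s0 s1 s2 s3 : CC p}
    (h : Tet i j k s0 s1 s2 s3) (hall : ∀ b ∈ B, cl b = s0 ∨ cl b = s1 ∨ cl b = s2 ∨ cl b = s3)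
    {f : GG p → GG p} (hfB : ∀ g, f g ∈ B)
    (h4 : ∀ g g', cl g = cl g' → g ≠ g' → ∃ m, g m ≠ g' m ∧ cl (f g) m = cl (f g') m)
    {γ : CC p} {h0 h1 h2 : GG p} (c0 : cl h0 = γ) (c1 : cl h1 = γ) (c2 : cl h2 = γ)
    (t0 : cl (f h0) = s0) (t1 : cl (f h1) = s1) (t2 : cl (f h2) = s2) : False := by
  obtain ⟨hij, hik, hjk, b1, b2, b3, c1', c2', c3, d1, d2, d3⟩ := h
  have e1 : cl (f (mix i j k h1 h0 h0)) = s1 := by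
    have q1 := one_mv h4 (g := mix i j k h1 h0 h0) (g' := h0)
      (by rw [cl_mix c1 c0 c0, c0]) i (by
        intro m hm
        rcases fin3 hij hik hjk m with rfl | rfl | rfl
        · exact absurd rfl hm
        · exact mix_j hij _ _ _
        · exact mix_k hik hjk _ _ _)
    have q2 := two_mv h4 (g := mix i j k h1 h0 h0) (g' := h1)
      (by rw [cl_mix c1 c0 c0, c1]) hij hik hjk (mix_i _ _ _)
    rw [t0] at q1; rw [t1] at q2
    rcases hall _ (hfB (mix i j k h1 h0 h0)) with e | e | e | e <;> rw [e] at q1 q2 ⊢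
    · rcases q2 with q2 | q2
      · exact absurd q2.symm c3
      · exact absurd q2.symm d3
    · exact absurd q1 b3
    · rw [b2] at q1; exact absurd q1 b3
  have e2 : cl (f (mix i j k h0 h2 h0)) = s2 := by
    have q1 := one_mv h4 (g := mix i j k h0 h2 h0) (g' := h0)
      (by rw [cl_mix c0 c2 c0, c0]) j (by
        intro m hm
        rcases fin3 hij hik hjk m with rfl | rfl | rfl
        · exact mix_i _ _ _
        · exact absurd rfl hm
        · exact mix_k hik hjk _ _ _)
    have q2 := two_mv h4 (g := mix i j k h0 h2 h0) (g' := h2)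
      (by rw [cl_mix c0 c2 c0, c2]) hij.symm hjk hik (mix_j hij _ _ _)
    rw [t0] at q1; rw [t2] at q2
    rcases hall _ (hfB (mix i j k h0 h2 h0)) with e | e | e | e <;> rw [e] at q1 q2 ⊢
    · rcases q2 with q2 | q2
      · exact absurd q2.symm b3
      · rw [d2] at q2; exact absurd q2.symm d3
    · exact absurd q1 c3
    · rw [c2'] at q1; exact absurd q1 c3
  have q1 := one_mv h4 (g := mix i j k h1 h2 h0) (g' := mix i j k h1 h0 h0)
      (by rw [cl_mix c1 c2 c0, cl_mix c1 c0 c0]) j (by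
        intro m hm
        rcases fin3 hij hik hjk m with rfl | rfl | rfl
        · rw [mix_i, mix_i]
        · exact absurd rfl hm
        · rw [mix_k hik hjk, mix_k hik hjk])
  have q2 := one_mv h4 (g := mix i j k h1 h2 h0) (g' := mix i j k h0 h2 h0)
      (by rw [cl_mix c1 c2 c0, cl_mix c0 c2 c0]) i (by
        intro m hm
        rcases fin3 hij hik hjk m with rfl | rfl | rfl
        · exact absurd rfl hm
        · rw [mix_j hij, mix_j hij]
        · rw [mix_k hik hjk, mix_k hik hjk])
  have q3 := two_mv h4 (g := mix i j k h1 h2 h0) (g' := h0)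
      (by rw [cl_mix c1 c2 c0, c0]) hik.symm hjk.symm hij (mix_k hik hjk _ _ _)
  rw [e1] at q1; rw [e2] at q2; rw [t0, q1, q2] at q3
  rcases q3 with q3 | q3
  · exact b3 q3
  · exact c3 q3

lemma tet_arith (n0 n1 n2 n3 w0 w1 w2 w3 N : ℕ) (h0 : 0 < n0) (h1 : 0 < n1) (h2 : 0 < n2)
    (h3 : 0 < n3) (hN : n0 + n1 + n2 + n3 = N) (h4 : ¬ 4 ∣ N)
    (e0 : n0 * w0 + n1 * w1 + n2 * w2 + n3 * w3 = N)
    (e1 : n0 * w1 + n1 * w0 + n2 * w3 + n3 * w2 = N)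
    (e2 : n0 * w2 + n1 * w3 + n2 * w0 + n3 * w1 = N)
    (e3 : n0 * w3 + n1 * w2 + n2 * w1 + n3 * w0 = N)
    (z0 : ¬ (w0 ≠ 0 ∧ w1 ≠ 0 ∧ w2 ≠ 0)) (z1 : ¬ (w0 ≠ 0 ∧ w1 ≠ 0 ∧ w3 ≠ 0))
    (z2 : ¬ (w0 ≠ 0 ∧ w2 ≠ 0 ∧ w3 ≠ 0)) (z3 : ¬ (w1 ≠ 0 ∧ w2 ≠ 0 ∧ w3 ≠ 0)) :
    2 ∣ N ∧ ((w0 = 2 ∧ w1 = 2 ∧ w2 = 0 ∧ w3 = 0 ∧ 2 * (n0 + n1) = N) ∨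
      (w0 = 0 ∧ w1 = 0 ∧ w2 = 2 ∧ w3 = 2 ∧ 2 * (n2 + n3) = N) ∨ (w0 = 0 ↔ w1 ≠ 0)) := by
  have hs : w0 + w1 + w2 + w3 = 4 := by
    have : N * (w0 + w1 + w2 + w3) = N * 4 := by
      rw [← hN]; rw [← hN] at e0 e1 e2 e3; linarith
    exact Nat.eq_of_mul_eq_mul_left (by omega) this
  have b0 : w0 ≤ 4 := by omega
  have b1 : w1 ≤ 4 := by omega
  have b2 : w2 ≤ 4 := by omega
  obtain rfl : w3 = 4 - w0 - w1 - w2 := by omega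
  interval_cases w0 <;> interval_cases w1 <;> interval_cases w2 <;> simp at * <;> omega

end three


section threeb
variable {p : Fin 3 → ℕ} [hp : ∀ i, Fact (p i).Prime]

lemma UT.cfm {A B : Finset (GG p)} (h : UT A B) (v : CC p) (hv : ∀ i, v i ≠ 0) (β : CC p) :
    ∑ b ∈ B, wt A (β - v * cl b) = NN p := by
  obtain ⟨u, hu, rfl⟩ := exists_unit v hv
  rw [← (h.mul hu).cf β]
  unfold mulS
  rw [Finset.sum_image (fun _ _ _ _ e => hu.mul_left_cancel e)]
  refine Finset.sum_congr rfl fun b _ => ?_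
  rw [cl_mul]

lemma Tet.ne {i j k : Fin 3} {s0 s1 s2 s3 : CC p} (h : Tet i j k s0 s1 s2 s3) :
    s0 ≠ s1 ∧ s0 ≠ s2 ∧ s0 ≠ s3 ∧ s1 ≠ s2 ∧ s1 ≠ s3 ∧ s2 ≠ s3 := by
  obtain ⟨a1, a2, a3, b1, b2, b3, c1, c2, c3, d1, d2, d3⟩ := h
  refine ⟨?_, ?_, ?_, ?_, ?_, ?_⟩ <;> rintro rfl <;> simp_all

lemma Tet.sum {i j k : Fin 3} {s0 s1 s2 s3 : CC p} (h : Tet i j k s0 s1 s2 s3)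
    {B : Finset (GG p)} (hall : ∀ b ∈ B, cl b = s0 ∨ cl b = s1 ∨ cl b = s2 ∨ cl b = s3)
    (F : CC p → ℕ) : ∑ b ∈ B, F (cl b) = wt B s0 * F s0 + wt B s1 * F s1 + wt B s2 * F s2 +
      wt B s3 * F s3 := by
  obtain ⟨n1, n2, n3, n4, n5, n6⟩ := h.ne
  have : ∀ b ∈ B, F (cl b) = (if cl b = s0 then F s0 else 0) + (if cl b = s1 then F s1 else 0) +
      (if cl b = s2 then F s2 else 0) + (if cl b = s3 then F s3 else 0) := by
    intro b hb
    rcases hall b hb with e | e | e | e <;> rw [e] <;>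
      simp [n1, n2, n3, n4, n5, n6, n1.symm, n2.symm, n3.symm, n4.symm, n5.symm, n6.symm]
  rw [Finset.sum_congr rfl this]
  simp only [Finset.sum_add_distrib, ← Finset.sum_filter, Finset.sum_const, smul_eq_mul]
  rfl

lemma Tet.eq {A B : Finset (GG p)} (hU : UT A B) {i j k : Fin 3} {s0 s1 s2 s3 : CC p}
    (h : Tet i j k s0 s1 s2 s3) (hall : ∀ b ∈ B, cl b = s0 ∨ cl b = s1 ∨ cl b = s2 ∨ cl b = s3)
    (γ : CC p) : wt B s0 * wt A (γ - s1) + wt B s1 * wt A (γ - s0) + wt B s2 * wt A (γ - s3) +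
      wt B s3 * wt A (γ - s2) = NN p := by
  have hv : ∀ m, (fun m => if m = i then 1 else -1 : CC p) m ≠ 0 := by
    intro m; dsimp only; split_ifs
    · exact one_ne_zero
    · exact neg_ne_zero.2 one_ne_zero
  generalize hd : (fun m => if m = i then 1 else -1 : CC p) = d at hv
  have hs := h.sum hall (fun c => wt A ((γ - s1 + d * s0) - d * c))
  rw [hU.cfm d hv] at hs
  obtain ⟨a1, a2, a3, b1, b2, b3, c1, c2, c3, d1, d2, d3⟩ := h
  have di : d i = 1 := by rw [← hd]; simp
  have dj : d j = -1 := by rw [← hd]; simp [a1.symm]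
  have dk : d k = -1 := by rw [← hd]; simp [a2.symm]
  have E0 : γ - s1 + d * s0 - d * s0 = γ - s1 := by ring
  have E1 : γ - s1 + d * s0 - d * s1 = γ - s0 := by
    funext m
    rcases fin3 a1 a2 a3 m with rfl | rfl | rfl <;>
      simp only [Pi.sub_apply, Pi.add_apply, Pi.mul_apply, di, dj, dk, *] <;> ring
  have E2 : γ - s1 + d * s0 - d * s2 = γ - s3 := by
    funext m
    rcases fin3 a1 a2 a3 m with rfl | rfl | rfl <;>
      simp only [Pi.sub_apply, Pi.add_apply, Pi.mul_apply, di, dj, dk, b1, b2, c1, c2, d1, d2] <;>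
      ring
  have E3 : γ - s1 + d * s0 - d * s3 = γ - s2 := by
    funext m
    rcases fin3 a1 a2 a3 m with rfl | rfl | rfl <;>
      simp only [Pi.sub_apply, Pi.add_apply, Pi.mul_apply, di, dj, dk, b1, b2, c1, c2, d1, d2] <;>
      ring
  rw [E0, E1, E2, E3] at hs
  exact hs.symm

lemma not_four_dvd (hinj : Function.Injective p) : ¬ 4 ∣ NN p := by
  intro h
  rw [NN_eq (i := 0) (j := 1) (k := 2) (by decide) (by decide) (by decide)] at h
  have n01 : p 0 ≠ p 1 := fun e => absurd (hinj e) (by decide)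
  have n02 : p 0 ≠ p 2 := fun e => absurd (hinj e) (by decide)
  have n12 : p 1 ≠ p 2 := fun e => absurd (hinj e) (by decide)
  have aux : ∀ a b c : ℕ, a.Prime → b.Prime → c.Prime → a ≠ b → a ≠ c → b ≠ c → a = 2 →
      ¬ 4 ∣ a * b * c := by
    intro a b c ha hb hc h1 h2 h3 h4 h5
    subst h4
    have : 2 ∣ b * c := by
      rw [mul_assoc] at h5
      exact Nat.dvd_of_mul_dvd_mul_left (by norm_num : 0 < 2) h5
    rcases (Nat.prime_two.dvd_mul).1 this with e | e
    · exact h1 ((Nat.prime_dvd_prime_iff_eq Nat.prime_two hb).1 e)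
    · exact h2 ((Nat.prime_dvd_prime_iff_eq Nat.prime_two hc).1 e)
  have h2 : 2 ∣ p 0 * p 1 * p 2 := dvd_trans (by norm_num) h
  rcases (Nat.prime_two.dvd_mul).1 h2 with e | e
  · rcases (Nat.prime_two.dvd_mul).1 e with e | e
    · exact aux _ _ _ (hp 0).out (hp 1).out (hp 2).out n01 n02 n12
        ((Nat.prime_dvd_prime_iff_eq Nat.prime_two (hp 0).out).1 e).symm h
    · exact aux _ _ _ (hp 1).out (hp 0).out (hp 2).out n01.symm n12 n02
        ((Nat.prime_dvd_prime_iff_eq Nat.prime_two (hp 1).out).1 e).symm (by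
          rwa [mul_comm (p 1)])
  · exact aux _ _ _ (hp 2).out (hp 0).out (hp 1).out n02.symm n12.symm n01
        ((Nat.prime_dvd_prime_iff_eq Nat.prime_two (hp 2).out).1 e).symm (by
          rw [mul_comm, ← mul_assoc] at h; exact h)

/-- everything is in the class fibre if weights are nonzero -/
lemma exists_typed {A B : Finset (GG p)} {f : GG p → GG p}
    (h3 : ∀ a ∈ A, ∀ b ∈ B, f (a + b) = b) {γ s : CC p} (hb : wt B s ≠ 0)
    (ha : wt A (γ - s) ≠ 0) : ∃ g, cl g = γ ∧ cl (f g) = s := by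
  obtain ⟨b, hb', rfl⟩ := wt_pos.1 hb
  obtain ⟨a, ha', e⟩ := wt_pos.1 ha
  exact ⟨a + b, by rw [cl_add, e, sub_add_cancel], by rw [h3 a ha' b hb']⟩

lemma Tet.pair {A B : Finset (GG p)} (hinj : Function.Injective p) (hU : UT A B)
    (hB : B.card = NN p) {i j k : Fin 3} {s0 s1 s2 s3 : CC p}
    (h : Tet i j k s0 s1 s2 s3) (hall : ∀ b ∈ B, cl b = s0 ∨ cl b = s1 ∨ cl b = s2 ∨ cl b = s3)
    (m0 : wt B s0 ≠ 0) (m1 : wt B s1 ≠ 0) (m2 : wt B s2 ≠ 0) (m3 : wt B s3 ≠ 0) (γ : CC p) :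
    2 ∣ NN p ∧ ((wt A (γ - s0) = 2 ∧ wt A (γ - s1) = 2 ∧ wt A (γ - s2) = 0 ∧ wt A (γ - s3) = 0
        ∧ 2 * (wt B s0 + wt B s1) = NN p) ∨
      (wt A (γ - s0) = 0 ∧ wt A (γ - s1) = 0 ∧ wt A (γ - s2) = 2 ∧ wt A (γ - s3) = 2
        ∧ 2 * (wt B s2 + wt B s3) = NN p) ∨ (wt A (γ - s0) = 0 ↔ wt A (γ - s1) ≠ 0)) := by
  obtain ⟨f, h1, h2, h3, h4⟩ := hU.dec
  have a1 : ∀ b ∈ B, cl b = s0 ∨ cl b = s1 ∨ cl b = s3 ∨ cl b = s2 := fun b hb => by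
    have := hall b hb; tauto
  have a2 : ∀ b ∈ B, cl b = s0 ∨ cl b = s2 ∨ cl b = s1 ∨ cl b = s3 := fun b hb => by
    have := hall b hb; tauto
  have a3 : ∀ b ∈ B, cl b = s0 ∨ cl b = s2 ∨ cl b = s3 ∨ cl b = s1 := fun b hb => by
    have := hall b hb; tauto
  have a4 : ∀ b ∈ B, cl b = s0 ∨ cl b = s3 ∨ cl b = s1 ∨ cl b = s2 := fun b hb => by
    have := hall b hb; tauto
  have a5 : ∀ b ∈ B, cl b = s1 ∨ cl b = s0 ∨ cl b = s3 ∨ cl b = s2 := fun b hb => by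
    have := hall b hb; tauto
  have a6 : ∀ b ∈ B, cl b = s1 ∨ cl b = s3 ∨ cl b = s2 ∨ cl b = s0 := fun b hb => by
    have := hall b hb; tauto
  have ht : ∀ {s}, wt B s ≠ 0 → wt A (γ - s) ≠ 0 → ∃ g, cl g = γ ∧ cl (f g) = s :=
    fun hb ha => exists_typed h3 hb ha
  refine tet_arith (wt B s0) (wt B s1) (wt B s2) (wt B s3) _ _ _ _ (NN p)
    (Nat.pos_of_ne_zero m0) (Nat.pos_of_ne_zero m1) (Nat.pos_of_ne_zero m2)
    (Nat.pos_of_ne_zero m3) ?_ (not_four_dvd hinj) ?_ ?_ ?_ ?_ ?_ ?_ ?_ ?_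
  · have := h.sum hall (fun _ => 1)
    simp only [mul_one, Finset.sum_const, smul_eq_mul, hB] at this
    exact this.symm
  · rw [← h.sum hall (fun c => wt A (γ - c))]; exact hU.cf γ
  · exact h.eq hU hall γ
  · have := h.swij.eq hU a2 γ
    rw [← this]; ring
  · have := h.swjk.swij.eq hU a4 γ
    rw [← this]; ring
  · rintro ⟨x, y, z⟩
    obtain ⟨g0, c0, t0⟩ := ht m0 x
    obtain ⟨g1, c1, t1⟩ := ht m1 y
    obtain ⟨g2, c2, t2⟩ := ht m2 z
    exact h.noTriple hU hall h1 h4 c0 c1 c2 t0 t1 t2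
  · rintro ⟨x, y, z⟩
    obtain ⟨g0, c0, t0⟩ := ht m0 x
    obtain ⟨g1, c1, t1⟩ := ht m1 y
    obtain ⟨g2, c2, t2⟩ := ht m3 z
    exact h.swjk.noTriple hU a1 h1 h4 c0 c1 c2 t0 t1 t2
  · rintro ⟨x, y, z⟩
    obtain ⟨g0, c0, t0⟩ := ht m0 x
    obtain ⟨g1, c1, t1⟩ := ht m2 y
    obtain ⟨g2, c2, t2⟩ := ht m3 z
    exact h.swij.swjk.noTriple hU a3 h1 h4 c0 c1 c2 t0 t1 t2
  · rintro ⟨x, y, z⟩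
    obtain ⟨g0, c0, t0⟩ := ht m1 x
    obtain ⟨g1, c1, t1⟩ := ht m3 z
    obtain ⟨g2, c2, t2⟩ := ht m2 y
    exact h.cen.swij.swjk.noTriple hU a6 h1 h4 c0 c1 c2 t0 t1 t2

/-- counting elements of a given type in a fibre -/
lemma card_type {A B : Finset (GG p)} (hU : UT A B) {f : GG p → GG p} (h1 : ∀ g, f g ∈ B)
    (h2 : ∀ g, g - f g ∈ A) (h3 : ∀ a ∈ A, ∀ b ∈ B, f (a + b) = b) (γ s : CC p) :
    (univ.filter fun g => cl g = γ ∧ cl (f g) = s).card = wt B s * wt A (γ - s) := by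
  rw [hU.count (fun g => cl g = γ) (fun b => cl b = s) f h1 h2 h3, ← Finset.sum_filter]
  unfold wt
  rw [← smul_eq_mul, ← Finset.sum_const]
  refine Finset.sum_congr rfl fun b hb => ?_
  rw [← (mem_filter.1 hb).2]
  congr 1
  refine Finset.filter_congr fun a _ => ?_
  rw [cl_add, eq_sub_iff_add_eq]

lemma Tet.nopair {A B : Finset (GG p)} (hinj : Function.Injective p) (hU : UT A B)
    {i j k : Fin 3} {s0 s1 s2 s3 : CC p}
    (h : Tet i j k s0 s1 s2 s3) (hall : ∀ b ∈ B, cl b = s0 ∨ cl b = s1 ∨ cl b = s2 ∨ cl b = s3)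
    (h2i : p i = 2) (m0 : wt B s0 ≠ 0) (m1 : wt B s1 ≠ 0) (γ : CC p)
    (hw0 : wt A (γ - s0) = 2) (hw1 : wt A (γ - s1) = 2) (hw2 : wt A (γ - s2) = 0)
    (hw3 : wt A (γ - s3) = 0) (hn : 2 * (wt B s0 + wt B s1) = NN p) : False := by
  obtain ⟨f, h1, h2, h3, h4⟩ := hU.dec
  obtain ⟨a1, a2, a3, b1, b2, b3, c1, c2, c3, d1, d2, d3⟩ := h
  have nj : p j ≠ 2 := fun e => a1 (hinj (h2i.trans e.symm))
  have nk : p k ≠ 2 := fun e => a2 (hinj (h2i.trans e.symm))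
  have oj := (hp j).out.odd_of_ne_two nj
  have ok := (hp k).out.odd_of_ne_two nk
  have types : ∀ g, cl g = γ → cl (f g) = s0 ∨ cl (f g) = s1 := by
    intro g hg
    rcases hall _ (h1 g) with e | e | e | e
    · exact Or.inl e
    · exact Or.inr e
    · exfalso
      refine absurd hw2 (wt_pos.2 ⟨g - f g, h2 g, ?_⟩)
      rw [cl_sub, hg, e]
    · exfalso
      refine absurd hw3 (wt_pos.2 ⟨g - f g, h2 g, ?_⟩)
      rw [cl_sub, hg, e]
  have main : ∀ s, (s = s0 ∨ s = s1) → wt A (γ - s) = 2 → p j * p k ∣ wt B s := by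
    intro s hs hw
    have hc := card_type hU h1 h2 h3 γ s
    rw [hw] at hc
    have hin : ∀ l, (s0 l ≠ s1 l) → p l ∣ wt B s * 2 := by
      intro l hl
      rw [← hc]
      refine dvd_card_of_inv l _ ?_
      intro g hg t
      simp only [mem_filter, mem_univ, true_and] at hg ⊢
      have cg : cl (g + mv l t) = γ := by rw [cl_add, cl_mv, add_zero, hg.1]
      refine ⟨cg, ?_⟩
      have q := one_mv h4 (g := g + mv l t) (g' := g) (by rw [cg, hg.1]) l (by
        intro m hm; simp [mv, hm])
      rw [hg.2] at q
      rcases types _ cg with e | e <;> rcases hs with rfl | rfl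
      · exact e
      · rw [e] at q; exact absurd q hl
      · rw [e] at q; exact absurd q.symm hl
      · exact e
    have dj := (Nat.Coprime.dvd_of_dvd_mul_right (oj.coprime_two_right) (hin j (Ne.symm c3)))
    have dk := (Nat.Coprime.dvd_of_dvd_mul_right (ok.coprime_two_right) (hin k (Ne.symm d3)))
    exact Nat.Coprime.mul_dvd_of_dvd_of_dvd
      ((Nat.coprime_primes (hp j).out (hp k).out).2 fun e => a3 (hinj e)) dj dk
  have e0 := Nat.le_of_dvd (Nat.pos_of_ne_zero m0) (main s0 (Or.inl rfl) hw0)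
  have e1 := Nat.le_of_dvd (Nat.pos_of_ne_zero m1) (main s1 (Or.inr rfl) hw1)
  rw [NN_eq a1 a2 a3, h2i, mul_assoc] at hn
  have : 0 < p j * p k := Nat.mul_pos (hp j).out.pos (hp k).out.pos
  omega

lemma Tet.false_of_two {A B : Finset (GG p)} (hinj : Function.Injective p) (hU : UT A B)
    (hB : B.card = NN p) {i j k : Fin 3} {s0 s1 s2 s3 : CC p}
    (h : Tet i j k s0 s1 s2 s3) (hall : ∀ b ∈ B, cl b = s0 ∨ cl b = s1 ∨ cl b = s2 ∨ cl b = s3)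
    (m0 : wt B s0 ≠ 0) (m1 : wt B s1 ≠ 0) (m2 : wt B s2 ≠ 0) (m3 : wt B s3 ≠ 0)
    (h2i : p i = 2) : False := by
  have key : ∀ γ, (wt A (γ - s0) = 0 ↔ wt A (γ - s1) ≠ 0) := by
    intro γ
    rcases (h.pair hinj hU hB hall m0 m1 m2 m3 γ).2 with ⟨x0, x1, x2, x3, x4⟩ | ⟨x0, x1, x2, x3, x4⟩ | x
    · exact (h.nopair hinj hU hall h2i m0 m1 γ x0 x1 x2 x3 x4).elim
    · have hT : Tet i j k s2 s3 s0 s1 := h.swij.cen.swij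
      exact (hT.nopair hinj hU (fun b hb => by
        have := hall b hb; tauto) h2i m2 m3 γ x2 x3 x0 x1 x4).elim
    · exact x
  obtain ⟨a1, a2, a3, b1, b2, b3, c1, c2, c3, d1, d2, d3⟩ := h
  have nj : p j ≠ 2 := fun e => a1 (hinj (h2i.trans e.symm))
  have nk : p k ≠ 2 := fun e => a2 (hinj (h2i.trans e.symm))
  have oj := (hp j).out.odd_of_ne_two nj
  have ok := (hp k).out.odd_of_ne_two nk
  have step : ∀ δ : CC p, wt A (δ - (s1 - s0)) = 0 ↔ wt A δ ≠ 0 := by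
    intro δ
    have := key (δ + s0)
    rw [add_sub_cancel_right] at this
    have e : δ + s0 - s1 = δ - (s1 - s0) := by ring
    rw [e] at this
    tauto
  have iter : ∀ n : ℕ, wt A (-((2 * n) • (s1 - s0))) = 0 ↔ wt A 0 = 0 := by
    intro n
    induction n with
    | zero => simp
    | succ n ih =>
      have e1 := step (-((2 * n) • (s1 - s0)) - (s1 - s0))
      have e2 := step (-((2 * n) • (s1 - s0)))
      have e3 : -((2 * n) • (s1 - s0)) - (s1 - s0) - (s1 - s0) = -((2 * (n + 1)) • (s1 - s0)) := by
        simp only [nsmul_eq_mul]; push_cast; ring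
      rw [e3] at e1
      tauto
  obtain ⟨n, hn⟩ := oj.mul ok
  have e1 := step (-((2 * n) • (s1 - s0)))
  have e2 : -((2 * n) • (s1 - s0)) - (s1 - s0) = 0 := by
    have : (p j * p k) • (s1 - s0) = 0 := by
      funext m
      rcases fin3 a1 a2 a3 m with rfl | rfl | rfl <;> simp [b1]
    rw [hn] at this
    have e : -((2 * n) • (s1 - s0)) - (s1 - s0) = - ((2 * n + 1) • (s1 - s0)) := by
      simp only [nsmul_eq_mul]; push_cast; ring
    rw [e, this, neg_zero]
  rw [e2] at e1
  have := iter n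
  tauto

lemma Tet.false {A B : Finset (GG p)} (hinj : Function.Injective p) (hU : UT A B)
    (hB : B.card = NN p) {i j k : Fin 3} {s0 s1 s2 s3 : CC p}
    (h : Tet i j k s0 s1 s2 s3) (hall : ∀ b ∈ B, cl b = s0 ∨ cl b = s1 ∨ cl b = s2 ∨ cl b = s3)
    (m0 : wt B s0 ≠ 0) (m1 : wt B s1 ≠ 0) (m2 : wt B s2 ≠ 0) (m3 : wt B s3 ≠ 0) : False := by
  have h2 := (h.pair hinj hU hB hall m0 m1 m2 m3 0).1
  rw [NN_eq h.ij h.ik h.jk] at h2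
  rcases (Nat.prime_two.dvd_mul).1 h2 with e | e
  · rcases (Nat.prime_two.dvd_mul).1 e with e | e
    · exact h.false_of_two hinj hU hB hall m0 m1 m2 m3
        ((Nat.prime_dvd_prime_iff_eq Nat.prime_two (hp _).out).1 e).symm
    · exact h.swij.false_of_two hinj hU hB (fun b hb => by have := hall b hb; tauto) m0 m2 m1 m3
        ((Nat.prime_dvd_prime_iff_eq Nat.prime_two (hp _).out).1 e).symm
  · exact h.swjk.swij.false_of_two hinj hU hB (fun b hb => by have := hall b hb; tauto) m0 m3 m1 m2
        ((Nat.prime_dvd_prime_iff_eq Nat.prime_two (hp _).out).1 e).symm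

lemma classify (V : Set (CC p)) (hntr : ∀ s ∈ V, ∀ t ∈ V, ∃ i, s i = t i)
    (hnc : ∀ i, ∃ s ∈ V, ∃ t ∈ V, s i ≠ t i) :
    (∃ c : CC p, ∀ b ∈ V, ∀ i j, i ≠ j → b i = c i ∨ b j = c j) ∨
    ∃ i j k, ∃ s0 ∈ V, ∃ s1 ∈ V, ∃ s2 ∈ V, ∃ s3 ∈ V, Tet i j k s0 s1 s2 s3 ∧
      ∀ b ∈ V, b = s0 ∨ b = s1 ∨ b = s2 ∨ b = s3 := by
  obtain ⟨s, hs, -⟩ := hnc 0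
  by_cases h1 : ∀ b ∈ V, ∀ i j, i ≠ j → b i = s i ∨ b j = s j
  · exact Or.inl ⟨s, h1⟩
  push Not at h1
  obtain ⟨t, ht, j, k, hjk, tj, tk⟩ := h1
  obtain ⟨i, ti⟩ := hntr t ht s hs
  have hij : i ≠ j := by rintro rfl; exact tj ti
  have hik : i ≠ k := by rintro rfl; exact tk ti
  have hint3 : ∀ s ∈ V, ∀ t ∈ V, s i = t i ∨ s j = t j ∨ s k = t k := by
    intro s hs t ht
    obtain ⟨m, hm⟩ := hntr s hs t ht
    rcases fin3 hij hik hjk m with rfl | rfl | rfl <;> tauto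
  have ext3 : ∀ s t : CC p, s i = t i → s j = t j → s k = t k → s = t := by
    intro s t h1 h2 h3
    funext m
    rcases fin3 hij hik hjk m with rfl | rfl | rfl <;> assumption
  have form : ∀ b ∈ V, b i ≠ s i → (b j = s j ∧ b k = t k) ∨ (b j = t j ∧ b k = s k) := by
    intro b hb hi
    have q1 := hint3 b hb s hs
    have q2 := hint3 b hb t ht
    rw [ti] at q2
    grind
  obtain ⟨b0, hb0, b0i⟩ : ∃ b ∈ V, b i ≠ s i := by
    obtain ⟨x, hx, y, hy, hxy⟩ := hnc i
    by_cases e : x i = s i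
    · exact ⟨y, hy, fun e' => hxy (e.trans e'.symm)⟩
    · exact ⟨x, hx, e⟩
  have cen : ∀ c : CC p, (∀ b ∈ V, (b i = c i ∨ b j = c j) ∧ (b i = c i ∨ b k = c k) ∧
      (b j = c j ∨ b k = c k)) → ∀ b ∈ V, ∀ i j, i ≠ j → b i = c i ∨ b j = c j := by
    intro c hc b hb i' j' hij'
    obtain ⟨q1, q2, q3⟩ := hc b hb
    rcases fin3 hij hik hjk i' with rfl | rfl | rfl <;>
      rcases fin3 hij hik hjk j' with rfl | rfl | rfl <;> tauto
  by_cases hI : ∃ b1 ∈ V, b1 i ≠ s i ∧ b1 j = s j ∧ b1 k = t k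
  · obtain ⟨b1, hb1, b1i, b1j, b1k⟩ := hI
    by_cases hII : ∃ b2 ∈ V, b2 i ≠ s i ∧ b2 j = t j ∧ b2 k = s k
    · obtain ⟨b2, hb2, b2i, b2j, b2k⟩ := hII
      have b12 := hint3 b1 hb1 b2 hb2
      rw [b1j, b2j, b1k, b2k] at b12
      have b12i : b1 i = b2 i := by grind
      right
      refine ⟨i, j, k, s, hs, t, ht, b1, hb1, b2, hb2, ⟨hij, hik, hjk, ti, b12i.symm, b1i, b1j, b2j,
        tj, b2k, b1k, tk⟩, ?_⟩
      intro b hb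
      have q1 := hint3 b hb b1 hb1
      have q2 := hint3 b hb b2 hb2
      by_cases e : b i = s i
      · rw [e] at q1 q2
        have q3 : b j = s j ∨ b k = t k := by grind
        have q4 : b j = t j ∨ b k = s k := by grind
        by_cases e2 : b j = s j
        · left; exact ext3 _ _ e e2 (by grind)
        · right; left; exact ext3 _ _ (e.trans ti.symm) (by grind) (by grind)
      · right; right
        rcases form b hb e with ⟨f1, f2⟩ | ⟨f1, f2⟩
        · left; exact ext3 _ _ (by grind) (by grind) (by grind)
        · right; exact ext3 _ _ (by grind) (by grind) (by grind)
    · left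
      push Not at hII
      refine ⟨Function.update s k (t k), cen _ ?_⟩
      intro b hb
      rw [Function.update_self, Function.update_of_ne hik, Function.update_of_ne hjk]
      have q1 := hint3 b hb b1 hb1
      have q2 := form b hb
      have q3 := hII b hb
      grind
  · left
    push Not at hI
    have q0 := form b0 hb0 b0i
    have q0' := hI b0 hb0 b0i
    refine ⟨Function.update s j (t j), cen _ ?_⟩
    intro b hb
    rw [Function.update_self, Function.update_of_ne hij, Function.update_of_ne hjk.symm]
    have q1 := hint3 b hb b0 hb0
    have q2 := form b hb
    have q3 := hI b hb
    grind

/-- the majority structure -/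
structure Maj (A B : Finset (GG p)) : Prop where
  inj : Function.Injective p
  ut : UT A B
  cA : A.card = NN p
  cB : B.card = NN p
  maj : ∀ b ∈ B, ∀ i j, i ≠ j → cl b i = 0 ∨ cl b j = 0
  hB : ∀ i, ∃ b ∈ B, cl b i ≠ 0
  hA : ∀ i, ∃ a ∈ A, ∃ a' ∈ A, cl a i ≠ cl a' i

lemma Maj.mul {A B : Finset (GG p)} (h : Maj A B) {u : GG p} (hu : IsUnit u) :
    Maj A (mulS u B) := by
  have hu' := (isUnit_iff_cl u).1 hu
  refine ⟨h.inj, h.ut.mul hu, h.cA, by rw [card_mulS hu, h.cB], ?_, ?_, h.hA⟩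
  · intro b hb i j hij
    obtain ⟨c, hc, rfl⟩ := mem_mulS.1 hb
    rw [cl_mul]
    rcases h.maj c hc i j hij with e | e
    · left; simp [e]
    · right; simp [e]
  · intro i
    obtain ⟨b, hb, hbi⟩ := h.hB i
    exact ⟨u * b, mem_mulS.2 ⟨b, hb, rfl⟩, by
      rw [cl_mul]; exact mul_ne_zero (hu' i) hbi⟩

lemma exists_maj {A B : Finset (GG p)} (hinj : Function.Injective p) (hU : UT A B)
    (hA : A.card = NN p) (hB : B.card = NN p)
    (hntr : ∀ b ∈ B, ∀ b' ∈ B, ∃ i, cl b i = cl b' i)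
    (hncB : ∀ i, ∃ b ∈ B, ∃ b' ∈ B, cl b i ≠ cl b' i)
    (hncA : ∀ i, ∃ a ∈ A, ∃ a' ∈ A, cl a i ≠ cl a' i) :
    ∃ c, Maj A (trS c B) := by
  have := classify (cl '' (B : Set (GG p))) (by
      rintro _ ⟨b, hb, rfl⟩ _ ⟨b', hb', rfl⟩; exact hntr b hb b' hb') (by
      intro i
      obtain ⟨b, hb, b', hb', e⟩ := hncB i
      exact ⟨_, ⟨b, hb, rfl⟩, _, ⟨b', hb', rfl⟩, e⟩)
  rcases this with ⟨c, hc⟩ | ⟨i, j, k, _, ⟨b0, h0, rfl⟩, _, ⟨b1, h1, rfl⟩, _, ⟨b2, h2, rfl⟩, _, ⟨b3, h3, rfl⟩, hT, hall⟩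
  · obtain ⟨c, rfl⟩ := cl_surj c
    refine ⟨c, hinj, hU.tr c, hA, by rw [card_trS, hB], ?_, ?_, hncA⟩
    · intro x hx i j hij
      obtain ⟨b, hb, rfl⟩ := mem_trS.1 hx
      rw [cl_sub]
      simp only [Pi.sub_apply, sub_eq_zero]
      exact hc _ ⟨b, hb, rfl⟩ i j hij
    · intro i
      obtain ⟨b, hb, b', hb', e⟩ := hncB i
      by_cases q : cl b i = cl c i
      · refine ⟨b' - c, mem_trS.2 ⟨b', hb', rfl⟩, ?_⟩
        rw [cl_sub]; simp only [Pi.sub_apply, ne_eq, sub_eq_zero]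
        intro q'; exact e (q.trans q'.symm)
      · refine ⟨b - c, mem_trS.2 ⟨b, hb, rfl⟩, ?_⟩
        rw [cl_sub]; simpa only [Pi.sub_apply, ne_eq, sub_eq_zero] using q
  · exact (hT.false hinj hU hB (fun b hb => hall _ ⟨b, hb, rfl⟩) (wt_pos.2 ⟨b0, h0, rfl⟩)
      (wt_pos.2 ⟨b1, h1, rfl⟩) (wt_pos.2 ⟨b2, h2, rfl⟩) (wt_pos.2 ⟨b3, h3, rfl⟩)).elim
end threeb


section four
variable {p : Fin 3 → ℕ} [hp : ∀ i, Fact (p i).Prime]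

lemma Maj.single {A B : Finset (GG p)} (h : Maj A B) {b : GG p} (hb : b ∈ B) {i : Fin 3}
    (hi : cl b i ≠ 0) : cl b = Pi.single i (cl b i) := by
  funext m
  by_cases e : m = i
  · subst e; simp
  · rw [Pi.single_eq_of_ne e]
    exact (h.maj b hb m i e).resolve_right hi

lemma mult3 (x y : CC p) (hx : ∀ i, x i ≠ 0) (hy : ∀ i, y i ≠ 0) :
    ∃ v : CC p, (∀ i, v i ≠ 0) ∧ ∀ i, v i * x i = y i :=
  ⟨fun i => y i / x i, fun i => div_ne_zero (hy i) (hx i), fun i => div_mul_cancel₀ _ (hx i)⟩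

lemma mult1 (j : Fin 3) {y0 y : ZMod (p j)} (h0 : y0 ≠ 0) (h : y ≠ 0) :
    ∃ v : CC p, (∀ i, v i ≠ 0) ∧ v * Pi.single j y0 = Pi.single j y ∧ ∀ m, m ≠ j → v m = 1 := by
  refine ⟨Function.update 1 j (y / y0), ?_, ?_, fun m hm => by rw [Function.update_of_ne hm]; rfl⟩
  · intro i
    by_cases e : i = j
    · subst e; simpa using ⟨h, h0⟩
    · rw [Function.update_of_ne e]; exact one_ne_zero
  · funext m
    by_cases e : m = j
    · subst e; simp [h0]
    · simp [e]

/-- one-coordinate counts. -/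
def c1 (A : Finset (GG p)) (i : Fin 3) (u : ZMod (p i)) : ℕ := (A.filter fun a => cl a i = u).card

lemma sum_c1 (A : Finset (GG p)) (i : Fin 3) : ∑ u, c1 A i u = A.card := by
  symm
  exact Finset.card_eq_sum_card_fiberwise (f := fun a => cl a i) (t := univ) (fun g _ => by simp)

/-- sum over b grouped by i-class -/
lemma sum_group (B : Finset (GG p)) (i : Fin 3) (F : ZMod (p i) → ℕ) :
    ∑ b ∈ B, F (cl b i) = ∑ x, F x * c1 B i x := by
  rw [← Finset.sum_fiberwise_of_maps_to (t := univ) (g := fun b => cl b i) (fun _ _ => mem_univ _)]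
  refine Finset.sum_congr rfl fun x _ => ?_
  rw [Finset.sum_congr rfl (fun b hb => by rw [(mem_filter.1 hb).2]), Finset.sum_const, smul_eq_mul,
    mul_comm]
  rfl

lemma card_plane (i : Fin 3) (u u' : ZMod (p i)) :
    (univ.filter fun g : GG p => cl g i = u).card = (univ.filter fun g : GG p => cl g i = u').card := by
  obtain ⟨g0, h0⟩ := cl_surj (p := p) (Function.update 0 i (u' - u))
  have e0 : cl g0 i = u' - u := by rw [h0]; simp
  refine Finset.card_bij (fun g _ => g + g0) ?_ ?_ ?_
  · intro g hg
    simp only [mem_filter, mem_univ, true_and] at hg ⊢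
    rw [cl_add, Pi.add_apply, hg, e0]; ring
  · intro a _ b _ e; exact add_right_cancel e
  · intro g hg
    simp only [mem_filter, mem_univ, true_and] at hg
    refine ⟨g - g0, ?_, sub_add_cancel _ _⟩
    simp only [mem_filter, mem_univ, true_and]
    rw [cl_sub, Pi.sub_apply, hg, e0]; ring

lemma UT.c1_conv {A B : Finset (GG p)} (hU : UT A B) (i : Fin 3) (τ : ZMod (p i)) (hτ : τ ≠ 0)
    (u : ZMod (p i)) : ∑ x, c1 A i (u - τ * x) * c1 B i x =
      (univ.filter fun g : GG p => cl g i = u).card := by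
  obtain ⟨v, hv, e⟩ := exists_unit (p := p) (Function.update 1 i τ) (by
    intro m
    by_cases e : m = i
    · subst e; simpa using hτ
    · rw [Function.update_of_ne e]; exact one_ne_zero)
  rw [(hU.mul hv).count', mulS, Finset.sum_image (fun _ _ _ _ e => hv.mul_left_cancel e),
    ← sum_group B i (fun x => c1 A i (u - τ * x))]
  refine Finset.sum_congr rfl fun b _ => ?_
  unfold c1
  congr 1
  refine Finset.filter_congr fun a _ => ?_
  rw [cl_add, cl_mul, e, Pi.add_apply, Pi.mul_apply, Function.update_self, eq_sub_iff_add_eq]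

lemma UT.c1_const {A B : Finset (GG p)} (hU : UT A B) (i : Fin 3) :
    (∀ u u', c1 A i u = c1 A i u') ∨ (∀ u u', c1 B i u = c1 B i u') := by
  have := conv_lemma (p := p i) (fun u => (c1 A i u : ℤ)) (fun u => (c1 B i u : ℤ)) (by
    intro τ hτ u u'
    have e1 := hU.c1_conv i τ hτ u
    have e2 := hU.c1_conv i τ hτ u'
    rw [card_plane i u u', ← e2] at e1
    exact_mod_cast e1)
  simpa only [Nat.cast_inj] using this

lemma mul_c1_of_const {A : Finset (GG p)} {i : Fin 3} (h : ∀ u u', c1 A i u = c1 A i u')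
    (u : ZMod (p i)) : p i * c1 A i u = A.card := by
  rw [← sum_c1 A i, Finset.sum_congr rfl (fun u' _ => h u' u)]
  simp [ZMod.card]

lemma Maj.wt_single {A B : Finset (GG p)} (h : Maj A B) {i : Fin 3} {x : ZMod (p i)} (hx : x ≠ 0) :
    wt B (Pi.single i x) = c1 B i x := by
  unfold wt c1
  congr 1
  refine Finset.filter_congr fun b hb => ?_
  constructor
  · intro e; rw [e]; simp
  · intro e
    rw [h.single hb (i := i) (by rw [e]; exact hx), e]

lemma Maj.cross {A B : Finset (GG p)} (h : Maj A B) {i : Fin 3}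
    (hβ : ∀ u u', c1 B i u = c1 B i u') {j k : Fin 3} (hij : i ≠ j) (hik : i ≠ k) (hjk : j ≠ k) :
    (∀ γ, wt A γ ≤ p i) ∧ ∀ a a', wt A a ≠ 0 → wt A a' ≠ 0 → a i ≠ a' i → a k = a' k → a j = a' j := by
  have hcB : ∀ x, c1 B i x = p j * p k := by
    intro x
    have := mul_c1_of_const hβ x
    rw [h.cB, NN_eq hij hik hjk, mul_assoc] at this
    exact Nat.eq_of_mul_eq_mul_left (hp i).out.pos this
  have hpjk : 0 < p j * p k := Nat.mul_pos (hp j).out.pos (hp k).out.pos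
  obtain ⟨f, h1, h2, h3, h4⟩ := h.ut.dec
  have hct : ∀ (γ : CC p) (x : ZMod (p i)), x ≠ 0 → (univ.filter fun g => cl g = γ ∧ cl (f g) = Pi.single i x).card =
      p j * p k * wt A (γ - Pi.single i x) := by
    intro γ x hx
    rw [card_type h.ut h1 h2 h3, h.wt_single hx, hcB]
  have hle : ∀ (γ : CC p) (x : ZMod (p i)), x ≠ 0 → wt A (γ - Pi.single i x) ≤ p i := by
    intro γ x hx
    have := hct γ x hx
    have l : (univ.filter fun g => cl g = γ ∧ cl (f g) = Pi.single i x).card ≤ NN p := by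
      rw [← card_fiber γ]
      refine Finset.card_le_card fun g hg => ?_
      simp only [mem_filter, mem_univ, true_and] at hg ⊢
      exact hg.1
    rw [this, NN_eq hij hik hjk] at l
    refine le_of_mul_le_mul_left (a := p j * p k) ?_ hpjk
    linarith
  have hdvd : ∀ (γ : CC p) (x : ZMod (p i)), x ≠ 0 → p i ∣ wt A (γ - Pi.single i x) := by
    intro γ x hx
    have hd : p i ∣ p j * p k * wt A (γ - Pi.single i x) := by
      rw [← hct γ x hx]
      refine dvd_card_of_inv i _ ?_
      intro g hg t
      simp only [mem_filter, mem_univ, true_and] at hg ⊢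
      have cg : cl (g + mv i t) = γ := by rw [cl_add, cl_mv, add_zero, hg.1]
      refine ⟨cg, ?_⟩
      have q := one_mv h4 (g := g + mv i t) (g' := g) (by rw [cg, hg.1]) i (by
        intro m hm; simp [mv, hm])
      rw [hg.2, Pi.single_eq_same] at q
      rw [h.single (h1 _) (i := i) (by rw [q]; exact hx), q]
    refine Nat.Coprime.dvd_of_dvd_mul_left ?_ hd
    exact Nat.Coprime.mul_right
      ((Nat.coprime_primes (hp i).out (hp j).out).2 fun e => hij (h.inj e))
      ((Nat.coprime_primes (hp i).out (hp k).out).2 fun e => hik (h.inj e))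
  refine ⟨?_, ?_⟩
  · intro γ
    have := hle (γ + Pi.single i 1) 1 one_ne_zero
    rwa [add_sub_cancel_right] at this
  · intro a a' ha ha' hi hk
    by_contra hj
    have hx : a' i - a i ≠ 0 := sub_ne_zero.2 (Ne.symm hi)
    generalize hγ : a + Pi.single i (a' i - a i) = γ
    have eγ : γ - Pi.single i (a' i - a i) = a := by rw [← hγ]; abel
    have hw : wt A a = p i := by
      have l := hle γ _ hx
      have d := hdvd γ _ hx
      rw [eγ] at l d
      exact le_antisymm l (Nat.le_of_dvd (Nat.pos_of_ne_zero ha) d)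
    obtain ⟨b, hb, hbj⟩ := h.hB j
    have hbs := h.single hb hbj
    have hy : a j - a' j ≠ 0 := sub_ne_zero.2 hj
    obtain ⟨v, hv, ev, ev1⟩ := mult1 j hbj hy
    have hsum := h.ut.cfm v hv γ
    have hbi : cl b i = 0 := (h.maj b hb i j hij).resolve_right hbj
    have hsub : insert b (B.filter fun b => cl b i = a' i - a i) ⊆ B := by
      intro c hc
      rcases mem_insert.1 hc with rfl | hc
      · exact hb
      · exact (mem_filter.1 hc).1
    have hle2 := Finset.sum_le_sum_of_subset (f := fun b => wt A (γ - v * cl b)) hsub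
    rw [hsum, Finset.sum_insert (by
      intro hm
      rw [(mem_filter.1 hm).2] at hbi
      exact hx hbi)] at hle2
    have e1 : γ - v * cl b = a' := by
      rw [hbs, ev, ← hγ]
      funext m
      rcases fin3 hij hik hjk m with rfl | rfl | rfl
      · simp [hij]
      · simp [hij.symm]
      · simp [hik.symm, hjk.symm, hk]
    have e2 : ∀ c ∈ B.filter (fun b => cl b i = a' i - a i), wt A (γ - v * cl c) = p i := by
      intro c hc
      have hc2 := (mem_filter.1 hc).2
      rw [← hw]
      congr 1
      rw [h.single (mem_filter.1 hc).1 (i := i) (by rw [hc2]; exact hx), hc2]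
      refine Eq.trans ?_ eγ
      congr 1
      funext m
      by_cases e : m = i
      · subst e; simp [ev1 m hij]
      · simp [e]
    rw [e1, Finset.sum_congr rfl e2, Finset.sum_const, smul_eq_mul, NN_eq hij hik hjk] at hle2
    have e3 : (B.filter fun b => cl b i = a' i - a i).card = p j * p k := hcB _
    rw [e3] at hle2
    have : 0 < wt A a' := Nat.pos_of_ne_zero ha'
    nlinarith

lemma Maj.not_const_aux {A B : Finset (GG p)} (h : Maj A B) {i : Fin 3}
    (hβ : ∀ u u', c1 B i u = c1 B i u') {j k : Fin 3} (hij : i ≠ j) (hik : i ≠ k) (hjk : j ≠ k)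
    (h2 : p j ≠ 2) : False := by
  have hcB : ∀ x, c1 B i x = p j * p k := by
    intro x
    have := mul_c1_of_const hβ x
    rw [h.cB, NN_eq hij hik hjk, mul_assoc] at this
    exact Nat.eq_of_mul_eq_mul_left (hp i).out.pos this
  obtain ⟨hle, hc1⟩ := h.cross hβ hij hik hjk
  obtain ⟨-, hc2⟩ := h.cross hβ hik hij hjk.symm
  -- generic pair
  obtain ⟨a, a', ha, ha', hi, hj, hk⟩ : ∃ a a', wt A a ≠ 0 ∧ wt A a' ≠ 0 ∧ a i ≠ a' i ∧ a j ≠ a' j ∧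
      a k ≠ a' k := by
    obtain ⟨x, hx, y, hy, hxy⟩ := h.hA i
    obtain ⟨z, hz, z', hz', hzz⟩ := h.hA j
    have wx : wt A (cl x) ≠ 0 := wt_pos.2 ⟨x, hx, rfl⟩
    have wy : wt A (cl y) ≠ 0 := wt_pos.2 ⟨y, hy, rfl⟩
    have wz : wt A (cl z) ≠ 0 := wt_pos.2 ⟨z, hz, rfl⟩
    have wz' : wt A (cl z') ≠ 0 := wt_pos.2 ⟨z', hz', rfl⟩
    have claim : ∀ s t, wt A s ≠ 0 → wt A t ≠ 0 → s i ≠ t i → s j ≠ t j → ∃ a a', wt A a ≠ 0 ∧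
        wt A a' ≠ 0 ∧ a i ≠ a' i ∧ a j ≠ a' j ∧ a k ≠ a' k := fun s t hs ht hi hj =>
      ⟨s, t, hs, ht, hi, hj, fun hk => hj (hc1 s t hs ht hi hk)⟩
    by_cases e : cl x j = cl y j
    · obtain ⟨s, hs, hsj⟩ : ∃ s, wt A s ≠ 0 ∧ s j ≠ cl x j := by
        by_cases e : cl z j = cl x j
        · exact ⟨_, wz', fun e' => hzz (e.trans e'.symm)⟩
        · exact ⟨_, wz, e⟩
      by_cases e2 : s i = cl x i
      · exact claim s (cl y) hs wy (by rw [e2]; exact hxy) (by rw [← e]; exact hsj)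
      · exact claim s (cl x) hs wx e2 hsj
    · exact claim _ _ wx wy hxy e
  have hcard : ∃ v' : ZMod (p j), v' ≠ a j ∧ v' ≠ a' j := by
    have : ({a j, a' j} : Finset (ZMod (p j))).card < (univ : Finset (ZMod (p j))).card := by
      rw [Finset.card_univ, ZMod.card]
      have := Finset.card_le_two (a := a j) (b := a' j)
      have := (hp j).out.two_le
      omega
    obtain ⟨v', -, hv'⟩ := Finset.exists_mem_notMem_of_card_lt_card this
    exact ⟨v', by simpa [not_or] using hv'⟩
  obtain ⟨v', hv1, hv2⟩ := hcard
  generalize hγ : Function.update a k (a' k) = γ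
  have gi : γ i = a i := by rw [← hγ, Function.update_of_ne hik]
  have gj : γ j = a j := by rw [← hγ, Function.update_of_ne hjk]
  have gk : γ k = a' k := by rw [← hγ, Function.update_self]
  obtain ⟨b, hb, hbj⟩ := h.hB j
  have hbs := h.single hb hbj
  have hbi : cl b i = 0 := (h.maj b hb i j hij).resolve_right hbj
  obtain ⟨v, hv, ev, ev1⟩ := mult1 j hbj (sub_ne_zero.2 (Ne.symm hv1))
  have hsum := h.ut.cfm v hv γ
  have z1 : ∀ c ∈ B, cl c i ≠ 0 → wt A (γ - v * cl c) = 0 := by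
    intro c hc hci
    by_contra hne
    have hcj : cl c j = 0 := (h.maj c hc i j hij).resolve_left hci
    have hck : cl c k = 0 := (h.maj c hc i k hik).resolve_left hci
    have := hc2 (γ - v * cl c) a hne ha (by
      simp only [Pi.sub_apply, Pi.mul_apply, gi]
      intro e
      have : v i * cl c i = 0 := by linear_combination -e
      rw [ev1 i hij, one_mul] at this
      exact hci this) (by simp [gj, hcj])
    simp only [Pi.sub_apply, Pi.mul_apply, gk, hck, mul_zero, sub_zero] at this
    exact hk this.symm
  have z2 : wt A (γ - v * cl b) = 0 := by
    by_contra hne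
    have hbk : cl b k = 0 := (h.maj b hb j k hjk).resolve_left hbj
    have := hc1 (γ - v * cl b) a' hne ha' (by
      simp only [Pi.sub_apply, Pi.mul_apply, gi, hbi, mul_zero, sub_zero]; exact hi) (by
      simp [gk, hbk])
    rw [hbs, ev] at this
    simp only [Pi.sub_apply, gj, Pi.single_eq_same] at this
    apply hv2
    rw [← this]; ring
  have hlt : ∑ c ∈ B, wt A (γ - v * cl c) < ∑ c ∈ B, if cl c i = 0 then p i else 0 := by
    refine Finset.sum_lt_sum ?_ ⟨b, hb, ?_⟩
    · intro c hc
      split_ifs with e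
      · exact hle _
      · rw [z1 c hc e]
    · rw [z2, if_pos hbi]; exact (hp i).out.pos
  rw [hsum, ← Finset.sum_filter, Finset.sum_const, smul_eq_mul] at hlt
  have e3 : (B.filter fun b => cl b i = 0).card = p j * p k := hcB _
  rw [e3, NN_eq hij hik hjk] at hlt
  nlinarith

lemma Maj.equi {A B : Finset (GG p)} (h : Maj A B) (i : Fin 3) (u : ZMod (p i)) :
    p i * c1 A i u = NN p := by
  rcases h.ut.c1_const i with e | e
  · rw [mul_c1_of_const e, h.cA]
  · exfalso
    obtain ⟨j, k, hij, hik, hjk⟩ : ∃ j k : Fin 3, i ≠ j ∧ i ≠ k ∧ j ≠ k := by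
      clear e u
      revert i; decide
    by_cases h2 : p j = 2
    · exact h.not_const_aux e hik hij hjk.symm (fun e' => hjk (h.inj (h2.trans e'.symm)))
    · exact h.not_const_aux e hij hik hjk h2
end four


lemma double_conv {p q : ℕ} [hp : Fact p.Prime] [hq : Fact q.Prime] (F G : ZMod p → ZMod q → ℤ)
    (hE : ∀ τ σ, τ ≠ 0 → σ ≠ 0 → ∀ u c c2, ∑ x, ∑ c', F (u - τ * x) (c - σ * c') * G x c' =
      ∑ x, ∑ c', F (u - τ * x) (c2 - σ * c') * G x c') (u0 : ZMod p) (h0 : ∀ c, F u0 c = 0)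
    (hF : ¬ ∀ c c', ∑ u, F u c = ∑ u, F u c') (x : ZMod p) (c c' : ZMod q) : G x c = G x c' := by
  have hp0 : (p : ℤ) ≠ 0 := by exact_mod_cast hp.out.ne_zero
  have hG : ∀ c c', ∑ x, G x c = ∑ x, G x c' := by
    refine (conv_lemma (fun c => ∑ u, F u c) (fun c => ∑ x, G x c) ?_).resolve_left hF
    intro σ hσ c c2
    have tr : ∀ c, ∑ c', (∑ u, F u (c - σ * c')) * (∑ x, G x c') =
        ∑ u, ∑ x, ∑ c', F (u - 1 * x) (c - σ * c') * G x c' := by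
      intro c
      rw [Finset.sum_comm]
      simp_rw [Finset.mul_sum]
      rw [Finset.sum_comm]
      refine Finset.sum_congr rfl fun x _ => ?_
      conv_rhs => rw [Finset.sum_comm]
      refine Finset.sum_congr rfl fun c' _ => ?_
      rw [← Finset.sum_mul]
      congr 1
      exact (Equiv.sum_comp (Equiv.subRight (1 * x)) (fun u => F u (c - σ * c'))).symm
    rw [tr, tr]
    exact Finset.sum_congr rfl fun u _ => hE 1 σ one_ne_zero hσ u c c2
  have key : ∀ u x σ, σ ≠ 0 → ∀ c c2,
      ∑ c', (p * F u (c - σ * c') - ∑ u', F u' (c - σ * c')) * (p * G x c' - ∑ x', G x' c') =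
      ∑ c', (p * F u (c2 - σ * c') - ∑ u', F u' (c2 - σ * c')) * (p * G x c' - ∑ x', G x' c') := by
    intro u x σ hσ c c2
    have := lines_lemma (p := p)
      (fun u x => ∑ c', (F u (c - σ * c') - F u (c2 - σ * c')) * G x c') 0 (by
        intro u τ hτ
        have := hE τ σ hτ hσ u c c2
        rw [← sub_eq_zero, ← Finset.sum_sub_distrib] at this
        rw [← this]
        refine Finset.sum_congr rfl fun x _ => ?_
        rw [← Finset.sum_sub_distrib]
        refine Finset.sum_congr rfl fun c' _ => ?_
        ring) u x
    rw [← sub_eq_zero, ← this, ← Finset.sum_sub_distrib]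
    have e1 : ∑ u', ∑ c', (F u' (c - σ * c') - F u' (c2 - σ * c')) * G x c' =
        ∑ c', (∑ u', F u' (c - σ * c') - ∑ u', F u' (c2 - σ * c')) * G x c' := by
      rw [Finset.sum_comm]
      refine Finset.sum_congr rfl fun c' _ => ?_
      rw [← Finset.sum_mul, Finset.sum_sub_distrib]
    have e2 : ∑ x', ∑ c', (F u (c - σ * c') - F u (c2 - σ * c')) * G x' c' =
        ∑ c', (F u (c - σ * c') - F u (c2 - σ * c')) * ∑ x', G x' c' := by
      rw [Finset.sum_comm]
      refine Finset.sum_congr rfl fun c' _ => ?_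
      rw [← Finset.mul_sum]
    have e3 : ∑ x', ∑ u', ∑ c', (F u' (c - σ * c') - F u' (c2 - σ * c')) * G x' c' =
        ∑ c', (∑ u', F u' (c - σ * c') - ∑ u', F u' (c2 - σ * c')) * ∑ x', G x' c' := by
      have : ∀ x', ∑ u', ∑ c', (F u' (c - σ * c') - F u' (c2 - σ * c')) * G x' c' =
          ∑ c', (∑ u', F u' (c - σ * c') - ∑ u', F u' (c2 - σ * c')) * G x' c' := by
        intro x'
        rw [Finset.sum_comm]
        refine Finset.sum_congr rfl fun c' _ => ?_
        rw [← Finset.sum_mul, Finset.sum_sub_distrib]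
      rw [Finset.sum_congr rfl (fun x' _ => this x'), Finset.sum_comm]
      refine Finset.sum_congr rfl fun c' _ => ?_
      rw [← Finset.mul_sum]
    rw [e1, e2, e3]
    simp only [Finset.mul_sum (s := (univ : Finset (ZMod q)))]
    simp only [← Finset.sum_sub_distrib, ← Finset.sum_add_distrib]
    refine Finset.sum_congr rfl fun c' _ => ?_
    simp only [Finset.sum_sub_distrib]
    ring
  rcases conv_lemma (fun c => p * F u0 c - ∑ u', F u' c) (fun c => p * G x c - ∑ x', G x' c)
    (fun σ hσ c c2 => key u0 x σ hσ c c2) with h | h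
  · exfalso
    apply hF
    intro c c'
    have := h c c'
    simp only [h0] at this
    linarith
  · have h1 := h c c'
    have h2 := hG c c'
    rw [h2] at h1
    exact mul_left_cancel₀ hp0 (by linarith)

section five
variable {p : Fin 3 → ℕ} [hp : ∀ i, Fact (p i).Prime]

lemma Maj.step1_aux {A B : Finset (GG p)} (h : Maj A B) {f : GG p → GG p} (h1 : ∀ g, f g ∈ B)
    (h2 : ∀ g, g - f g ∈ A)
    (h4 : ∀ g g', cl g = cl g' → g ≠ g' → ∃ m, g m ≠ g' m ∧ cl (f g) m = cl (f g') m)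
    {β : CC p} (hw : wt A β = 0) {x y z : GG p} (cx : cl x = β) (cy : cl y = β) (cz : cl z = β)
    (tx : cl (f x) 0 ≠ 0) (ty : cl (f y) 1 ≠ 0) (tz : cl (f z) 2 ≠ 0) : False := by
  have h01 : (0 : Fin 3) ≠ 1 := by decide
  have h02 : (0 : Fin 3) ≠ 2 := by decide
  have h12 : (1 : Fin 3) ≠ 2 := by decide
  have some : ∀ g, cl g = β → ¬ cl (f g) 0 ≠ 0 → ¬ cl (f g) 1 ≠ 0 → cl (f g) 2 ≠ 0 := by
    intro g hg e0 e1 e2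
    push Not at e0 e1
    refine absurd hw (wt_pos.2 ⟨g - f g, h2 g, ?_⟩)
    rw [cl_sub, hg]
    have : cl (f g) = 0 := by
      funext m
      rcases fin3 h01 h02 h12 m with rfl | rfl | rfl <;> assumption
    rw [this, sub_zero]
  have g1 : cl (f (mix 0 1 2 z z x)) 2 ≠ 0 := by
    have := one_mv h4 (g := mix 0 1 2 z z x) (g' := z) (by rw [cl_mix cz cz cx, cz]) 2 (by
      intro m hm
      rcases fin3 h01 h02 h12 m with rfl | rfl | rfl
      · exact mix_i _ _ _
      · exact mix_j h01 _ _ _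
      · exact absurd rfl hm)
    rwa [this]
  have g2 : cl (f (mix 0 1 2 y z x)) 2 ≠ 0 := by
    have q1 := one_mv h4 (g := mix 0 1 2 y z x) (g' := mix 0 1 2 z z x)
      (by rw [cl_mix cy cz cx, cl_mix cz cz cx]) 0 (by
        intro m hm
        rcases fin3 h01 h02 h12 m with rfl | rfl | rfl
        · exact absurd rfl hm
        · rw [mix_j h01, mix_j h01]
        · rw [mix_k h02 h12, mix_k h02 h12])
    have q2 := two_mv h4 (g := mix 0 1 2 y z x) (g' := x)
      (by rw [cl_mix cy cz cx, cx]) h02.symm h12.symm h01 (mix_k h02 h12 _ _ _)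
    refine some _ (cl_mix cy cz cx) ?_ ?_
    · rw [q1]
      exact not_not.2 ((h.maj _ (h1 _) 0 2 h02).resolve_right g1)
    · intro e
      have e0 := (h.maj _ (h1 (mix 0 1 2 y z x)) 0 1 h01).resolve_right e
      have e1 := (h.maj _ (h1 x) 0 1 h01).resolve_left tx
      rcases q2 with q2 | q2
      · rw [e0] at q2; exact tx q2.symm
      · rw [e1] at q2; exact e q2
  have g3 : cl (f (mix 0 1 2 y z y)) 2 ≠ 0 := by
    have := one_mv h4 (g := mix 0 1 2 y z y) (g' := mix 0 1 2 y z x)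
      (by rw [cl_mix cy cz cy, cl_mix cy cz cx]) 2 (by
      intro m hm
      rcases fin3 h01 h02 h12 m with rfl | rfl | rfl
      · rw [mix_i, mix_i]
      · rw [mix_j h01, mix_j h01]
      · exact absurd rfl hm)
    rwa [this]
  have g4 : cl (f (mix 0 1 2 y z y)) 1 ≠ 0 := by
    have := one_mv h4 (g := mix 0 1 2 y z y) (g' := y)
      (by rw [cl_mix cy cz cy, cy]) 1 (by
      intro m hm
      rcases fin3 h01 h02 h12 m with rfl | rfl | rfl
      · exact mix_i _ _ _
      · exact absurd rfl hm
      · exact mix_k h02 h12 _ _ _)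
    rwa [this]
  rcases h.maj _ (h1 (mix 0 1 2 y z y)) 1 2 h12 with e | e
  · exact g4 e
  · exact g3 e

lemma Maj.step1 {A B : Finset (GG p)} (h : Maj A B) {β : CC p} (hw : wt A β = 0) :
    ∃ i, ∀ x, wt A (β - Pi.single i x) = 0 := by
  by_contra hcon
  push Not at hcon
  choose x hx using hcon
  choose b hb hbi using h.hB
  have hx0 : ∀ i, x i ≠ 0 := by
    intro i e
    have := hx i
    rw [e, Pi.single_zero, sub_zero] at this
    exact this hw
  obtain ⟨v, hv, e⟩ := mult3 (fun i => cl (b i) i) x hbi hx0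
  obtain ⟨u, hu, rfl⟩ := exists_unit v hv
  have h' := h.mul hu
  obtain ⟨f, h1, h2, h3, h4⟩ := h'.ut.dec
  have ex : ∀ i, ∃ g, cl g = β ∧ cl (f g) i ≠ 0 := by
    intro i
    obtain ⟨a, ha, ea⟩ := wt_pos.1 (hx i)
    have hm : u * b i ∈ mulS u B := mem_mulS.2 ⟨b i, hb i, rfl⟩
    have hc : cl (u * b i) i = x i := by rw [cl_mul]; exact e i
    have hs := h'.single hm (i := i) (by rw [hc]; exact hx0 i)
    rw [hc] at hs
    refine ⟨a + u * b i, by rw [cl_add, ea, hs, sub_add_cancel], ?_⟩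
    rw [h3 a ha _ hm, hc]; exact hx0 i
  obtain ⟨g0, c0, t0⟩ := ex 0
  obtain ⟨g1, c1, t1⟩ := ex 1
  obtain ⟨g2, c2, t2⟩ := ex 2
  exact h'.step1_aux h1 h2 h4 hw c0 c1 c2 t0 t1 t2

/-- inverse of embp -/
noncomputable def qt (p : ℕ) : ZMod (p ^ 2) → ZMod p := Function.invFun (embp p)

lemma qt_embp {q : ℕ} [Fact q.Prime] (t : ZMod q) : qt q (embp q t) = t :=
  Function.leftInverse_invFun embp_inj t

lemma embp_qt {q : ℕ} [Fact q.Prime] {x : ZMod (q ^ 2)} (h : redp q x = 0) : embp q (qt q x) = x := by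
  obtain ⟨t, rfl⟩ := (redp_eq_zero_iff x).1 h
  rw [qt_embp]

/-- grouping by i-class and j-kernel value -/
lemma sum_group2 (B : Finset (GG p)) (i j : Fin 3) (H : GG p → ℕ) :
    (∑ b ∈ B, if cl b j = 0 then H b else 0) =
      ∑ x, ∑ c, ∑ b ∈ B.filter (fun b => cl b i = x ∧ b j = embp (p j) c), H b := by
  rw [← Finset.sum_filter, ← Fintype.sum_prod_type']
  rw [← Finset.sum_fiberwise_of_maps_to (t := univ)
    (g := fun b : GG p => (cl b i, qt (p j) (b j))) (fun _ _ => mem_univ _)]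
  refine Finset.sum_congr rfl fun xc _ => ?_
  refine Finset.sum_congr ?_ fun _ _ => rfl
  ext b
  obtain ⟨x, c⟩ := xc
  simp only [mem_filter, Prod.mk.injEq]
  constructor
  · rintro ⟨⟨h1, h2⟩, h3, h4⟩
    exact ⟨h1, h3, by rw [← h4, embp_qt h2]⟩
  · rintro ⟨h1, h3, h4⟩
    refine ⟨⟨h1, ?_⟩, h3, by rw [h4, qt_embp]⟩
    unfold cl; rw [h4, redp_embp]

/-- counts for step 2 -/
def c2 (A : Finset (GG p)) (i j : Fin 3) (c0 : ZMod (p j ^ 2)) (u : ZMod (p i)) (c : ZMod (p j)) : ℕ :=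
  (A.filter fun a => cl a i = u ∧ a j = c0 + embp (p j) c).card

lemma UT.c2_conv {A B : Finset (GG p)} (hU : UT A B) {i j : Fin 3} (hij : i ≠ j)
    (c0 : ZMod (p j ^ 2)) (τ : ZMod (p i)) (σ : ZMod (p j)) (hτ : τ ≠ 0) (hσ : σ ≠ 0)
    (u : ZMod (p i)) (c c' : ZMod (p j)) :
    ∑ x, ∑ d, c2 A i j c0 (u - τ * x) (c - σ * d) * c2 B i j 0 x d =
    ∑ x, ∑ d, c2 A i j c0 (u - τ * x) (c' - σ * d) * c2 B i j 0 x d := by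
  obtain ⟨v, hv, e⟩ := exists_unit (p := p) (Function.update (Function.update 1 i τ) j σ) (by
    intro m
    by_cases e : m = j
    · subst e; simpa using hσ
    · rw [Function.update_of_ne e]
      by_cases e : m = i
      · subst e; simpa using hτ
      · rw [Function.update_of_ne e]; exact one_ne_zero)
  have vi : cl v i = τ := by rw [e, Function.update_of_ne hij]; simp
  have vj : cl v j = σ := by rw [e]; simp
  have hU' := hU.mul hv
  obtain ⟨f, h1, h2, h3, h4⟩ := hU'.dec
  have main : ∀ c, (univ.filter fun g => (cl g i = u ∧ g j = c0 + embp (p j) c) ∧ cl (f g) j = 0).card =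
      ∑ x, ∑ d, c2 A i j c0 (u - τ * x) (c - σ * d) * c2 B i j 0 x d := by
    intro c
    rw [hU'.count (fun g => cl g i = u ∧ g j = c0 + embp (p j) c) (fun b => cl b j = 0) f h1 h2 h3,
      mulS, Finset.sum_image (fun _ _ _ _ e => hv.mul_left_cancel e)]
    have : ∀ b ∈ B, (if cl (v * b) j = 0 then
        (A.filter fun a => cl (a + v * b) i = u ∧ (a + v * b) j = c0 + embp (p j) c).card else 0) =
        (if cl b j = 0 then
        (A.filter fun a => cl (a + v * b) i = u ∧ (a + v * b) j = c0 + embp (p j) c).card else 0) := by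
      intro b _
      congr 1
      rw [cl_mul, Pi.mul_apply, vj]
      simp [hσ]
    rw [Finset.sum_congr rfl this, sum_group2 B i j]
    refine Finset.sum_congr rfl fun x _ => Finset.sum_congr rfl fun d _ => ?_
    have e2 : c2 B i j 0 x d = (B.filter (fun b => cl b i = x ∧ b j = embp (p j) d)).card := by
      simp [c2]
    rw [e2, mul_comm, ← smul_eq_mul, ← Finset.sum_const]
    refine Finset.sum_congr rfl fun b hb => ?_
    obtain ⟨hb1, hb2, hb3⟩ := mem_filter.1 hb
    unfold c2
    congr 1
    refine Finset.filter_congr fun a _ => ?_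
    have q1 : (v * b) j = embp (p j) (σ * d) := by
      rw [Pi.mul_apply, hb3, ← vj]; exact (embp_mul _ _).symm
    rw [cl_add, cl_mul, Pi.add_apply, Pi.mul_apply, vi, hb2, eq_sub_iff_add_eq, Pi.add_apply, q1,
      embp_sub, ← add_sub_assoc, eq_sub_iff_add_eq]
  rw [← main, ← main]
  have half : ∀ c c', (univ.filter fun g => (cl g i = u ∧ g j = c0 + embp (p j) c) ∧ cl (f g) j = 0).card ≤
      (univ.filter fun g => (cl g i = u ∧ g j = c0 + embp (p j) c') ∧ cl (f g) j = 0).card := by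
    intro c c'
    refine Finset.card_le_card_of_injOn (fun g => g + mv j (c' - c)) ?_ (fun _ _ _ _ e => add_right_cancel e)
    intro g hg
    simp only [coe_filter, mem_univ, true_and, Set.mem_ofPred_eq] at hg ⊢
    have cg : cl (g + mv j (c' - c)) = cl g := by rw [cl_add, cl_mv, add_zero]
    refine ⟨⟨by rw [cg]; exact hg.1.1, ?_⟩, ?_⟩
    · rw [Pi.add_apply, hg.1.2]
      simp only [mv, Pi.single_eq_same]
      rw [embp_sub]; ring
    · rw [one_mv h4 cg j (by intro m hm; simp [mv, hm])]; exact hg.2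
  exact le_antisymm (half _ _) (half _ _)

lemma sum_c2_u (A : Finset (GG p)) (i j : Fin 3) (c0 : ZMod (p j ^ 2)) (c : ZMod (p j)) :
    ∑ u, c2 A i j c0 u c = (A.filter fun a => a j = c0 + embp (p j) c).card := by
  rw [Finset.card_eq_sum_card_fiberwise (f := fun a : GG p => cl a i) (t := univ) (fun g _ => by simp)]
  refine Finset.sum_congr rfl fun u _ => ?_
  unfold c2
  rw [Finset.filter_filter]
  congr 1
  refine Finset.filter_congr fun a _ => and_comm

lemma sum_c2 (A : Finset (GG p)) (j : Fin 3) (c0 : ZMod (p j ^ 2)) :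
    ∑ c, (A.filter fun a => a j = c0 + embp (p j) c).card = c1 A j (redp (p j) c0) := by
  unfold c1
  rw [Finset.card_eq_sum_card_fiberwise (f := fun a : GG p => qt (p j) (a j - c0)) (t := univ)
    (fun g _ => by simp)]
  refine Finset.sum_congr rfl fun c _ => ?_
  rw [Finset.filter_filter]
  congr 1
  refine Finset.filter_congr fun a _ => ?_
  constructor
  · intro e
    have e' : a j - c0 = embp (p j) c := by rw [e]; ring
    refine ⟨?_, by rw [e', qt_embp]⟩
    unfold cl; rw [e, map_add, redp_embp, add_zero]
  · rintro ⟨e1, e2⟩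
    have : embp (p j) (qt (p j) (a j - c0)) = a j - c0 := embp_qt (by
      rw [map_sub]; unfold cl at e1; rw [e1, sub_self])
    rw [← e2, this]; ring

lemma Maj.step2 {A B : Finset (GG p)} (h : Maj A B) {i j k : Fin 3} (hij : i ≠ j) (hik : i ≠ k)
    (hjk : j ≠ k) {u0 : ZMod (p i)} {v0 : ZMod (p j)} (hmiss : ∀ a ∈ A, cl a i = u0 → cl a j ≠ v0)
    (x : ZMod (p i)) (c c' : ZMod (p j)) : c2 B i j 0 x c = c2 B i j 0 x c' := by
  obtain ⟨c0, rfl⟩ := redp_surj v0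
  have := double_conv (fun u c => (c2 A i j c0 u c : ℤ)) (fun u c => (c2 B i j 0 u c : ℤ)) (by
    intro τ σ hτ hσ u c c'
    exact_mod_cast h.ut.c2_conv hij c0 τ σ hτ hσ u c c') u0 (by
    intro c
    have : c2 A i j c0 u0 c = 0 := by
      unfold c2
      rw [Finset.card_eq_zero, Finset.filter_eq_empty_iff]
      rintro a ha ⟨e1, e2⟩
      refine hmiss a ha e1 ?_
      unfold cl; rw [e2, map_add, redp_embp, add_zero]
    exact_mod_cast this) (by
    intro hc
    have hc' : ∀ c c', ∑ u, c2 A i j c0 u c = ∑ u, c2 A i j c0 u c' := by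
      intro c c'; exact_mod_cast hc c c'
    have s := sum_c2 A j c0
    simp_rw [← sum_c2_u A i j c0] at s
    rw [Finset.sum_congr rfl (fun c _ => hc' c 0), Finset.sum_const, Finset.card_univ, ZMod.card,
      smul_eq_mul] at s
    have e := h.equi j (redp (p j) c0)
    rw [← s, NN_eq hij.symm hjk hik, mul_assoc] at e
    have e := Nat.eq_of_mul_eq_mul_left (hp j).out.pos e
    have d : p j ∣ p i * p k := ⟨_, e.symm⟩
    rcases ((hp j).out.dvd_mul).1 d with d | d
    · exact hij (h.inj ((Nat.prime_dvd_prime_iff_eq (hp j).out (hp i).out).1 d)).symm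
    · exact hjk (h.inj ((Nat.prime_dvd_prime_iff_eq (hp j).out (hp k).out).1 d))) x c c'
  exact_mod_cast this

lemma Maj.step3 {A B : Finset (GG p)} (h : Maj A B) {i j k : Fin 3} (hij : i ≠ j) (hik : i ≠ k)
    (hjk : j ≠ k) {u0 : ZMod (p i)} {v0 : ZMod (p j)} (hmiss : ∀ a ∈ A, cl a i = u0 → cl a j ≠ v0)
    {a1 a2 : GG p} (ha1 : a1 ∈ A) (ha2 : a2 ∈ A) (e1 : cl a1 j = v0) (e2 : cl a2 j = v0) :
    cl a1 i = cl a2 i ∨ cl a1 k = cl a2 k := by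
  by_contra hcon
  push Not at hcon
  obtain ⟨ni, nk⟩ := hcon
  obtain ⟨b, hb, hbi⟩ := h.hB i
  obtain ⟨bz, hbz, hbzk⟩ := h.hB k
  obtain ⟨v, hv, ev⟩ := mult3 (Function.update (Function.update 1 i (cl b i)) k (cl bz k))
    (Function.update (Function.update 1 i (cl a1 i - cl a2 i)) k (cl a2 k - cl a1 k)) (by
      intro m
      rcases fin3 hij hik hjk m with rfl | rfl | rfl
      · simpa [hik] using hbi
      · simp [hjk, hij.symm]
      · simpa using hbzk) (by
      intro m
      rcases fin3 hij hik hjk m with rfl | rfl | rfl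
      · simpa [hik] using sub_ne_zero.2 ni
      · simp [hjk, hij.symm]
      · simpa using sub_ne_zero.2 (Ne.symm nk))
  have vi : v i * cl b i = cl a1 i - cl a2 i := by simpa [hik] using ev i
  have vj : v j = 1 := by simpa [hjk, hij.symm] using ev j
  have vk : v k * cl bz k = cl a2 k - cl a1 k := by simpa using ev k
  clear ev
  obtain ⟨u, hu, rfl⟩ := exists_unit v hv
  have h' := h.mul hu
  have hbzi : cl bz i = 0 := (h.maj bz hbz i k hik).resolve_right hbzk
  have hbzj : cl bz j = 0 := (h.maj bz hbz j k hjk).resolve_right hbzk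
  have hbj : cl b j = 0 := (h.maj b hb i j hij).resolve_left hbi
  obtain ⟨d, hd⟩ : ∃ d, (a1 + u * bz - a2) j = embp (p j) d := by
    rw [← redp_eq_zero_iff]
    show cl (a1 + u * bz - a2) j = 0
    rw [cl_sub, cl_add, cl_mul]
    simp [e1, e2, hbzj]
  obtain ⟨b', hb', hb'i, hb'j⟩ : ∃ b' ∈ B, cl b' i = cl b i ∧ b' j = embp (p j) d := by
    obtain ⟨c, hc⟩ := (redp_eq_zero_iff (b j)).1 hbj
    have := h.step2 hij hik hjk hmiss (cl b i) c d
    have pos : c2 B i j 0 (cl b i) c ≠ 0 := by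
      unfold c2
      rw [Finset.card_ne_zero]
      exact ⟨b, by simp [hb, hc]⟩
    rw [this] at pos
    unfold c2 at pos
    rw [Finset.card_ne_zero] at pos
    obtain ⟨b', hb'⟩ := pos
    refine ⟨b', ?_⟩
    simpa using hb'
  have hb'i0 : cl b' i ≠ 0 := by rw [hb'i]; exact hbi
  have hb'k : cl b' k = 0 := (h.maj b' hb' i k hik).resolve_left hb'i0
  have key := h'.ut.key ha1 ha2 (b := u * bz) (b' := u * b') (mem_mulS.2 ⟨_, hbz, rfl⟩)
    (mem_mulS.2 ⟨_, hb', rfl⟩) (by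
      intro m
      rcases fin3 hij hik hjk m with rfl | rfl | rfl
      · right
        refine ⟨ni, ?_⟩
        rw [cl_mul, cl_mul]
        simp only [Pi.mul_apply, hbzi, mul_zero, ne_eq]
        exact (mul_ne_zero (hv m) hb'i0).symm
      · left
        have : (u * b') m = embp (p m) d := by
          rw [Pi.mul_apply, hb'j, ← embp_mul]
          show embp (p m) (cl u m * d) = _
          rw [vj, one_mul]
        rw [Pi.add_apply a2, this, ← hd]
        simp
      · right
        refine ⟨nk, ?_⟩
        rw [cl_mul, cl_mul]
        simp only [Pi.mul_apply, hb'k, mul_zero, ne_eq]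
        exact mul_ne_zero (hv m) hbzk)
  exact ni (by rw [key.1])

lemma Maj.plane_sub {A B : Finset (GG p)} (h : Maj A B) {i j : Fin 3} (hij : i ≠ j)
    {u : ZMod (p i)} {v : ZMod (p j)} (hs : ∀ a ∈ A, cl a j = v → cl a i = u) : p i < p j := by
  have hle : c1 A j v ≤ c1 A i u := by
    unfold c1
    refine Finset.card_le_card fun a ha => ?_
    obtain ⟨h1, h2⟩ := mem_filter.1 ha
    exact mem_filter.2 ⟨h1, hs a h1 h2⟩
  have e1 := h.equi j v
  have e2 := h.equi i u
  have hN : 0 < NN p := Finset.prod_pos fun i _ => (hp i).out.pos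
  have hne : p i ≠ p j := fun e => hij (h.inj e)
  by_contra hcon
  have hlt : p j < p i := by omega
  have : 0 < c1 A i u := Nat.pos_of_ne_zero (by rintro e; rw [e] at e2; omega)
  have h5 : p j * c1 A j v ≤ p j * c1 A i u := Nat.mul_le_mul_left _ hle
  have h6 : p j * c1 A i u < p i * c1 A i u := Nat.mul_lt_mul_of_pos_right hlt this
  omega

lemma Maj.plane_dich {A B : Finset (GG p)} (h : Maj A B) {i j k : Fin 3} (hij : i ≠ j) (hik : i ≠ k)
    (hjk : j ≠ k) {u0 : ZMod (p i)} {v0 : ZMod (p j)} (hmiss : ∀ a ∈ A, cl a i = u0 → cl a j ≠ v0) :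
    (∃ u, ∀ a ∈ A, cl a j = v0 → cl a i = u) ∨ (∃ w, ∀ a ∈ A, cl a j = v0 → cl a k = w) := by
  by_contra hcon
  push Not at hcon
  obtain ⟨h1, h2⟩ := hcon
  have s := fun {a1 a2} => h.step3 hij hik hjk hmiss (a1 := a1) (a2 := a2)
  obtain ⟨x, hx, xj, -⟩ := h1 0
  obtain ⟨y, hy, yj, yi⟩ := h1 (cl x i)
  obtain ⟨z, hz, zj, zk⟩ := h2 (cl x k)
  have s1 := s hx hy xj yj
  have s2 := s hx hz xj zj
  have s3 := s hy hz yj zj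
  grind

lemma Maj.hit0 {A B : Finset (GG p)} (h : Maj A B) (h01 : p 0 < p 1) (h12 : p 1 < p 2) {j : Fin 3}
    (hj : j ≠ 0) (u : ZMod (p 0)) (v : ZMod (p j)) : ∃ a ∈ A, cl a 0 = u ∧ cl a j = v := by
  by_contra hcon
  push Not at hcon
  obtain ⟨k, hk0, hjk⟩ : ∃ k : Fin 3, k ≠ 0 ∧ j ≠ k := by
    clear hcon v; revert j; decide
  have lt0 : ∀ m : Fin 3, ¬ p m < p 0 := by
    intro m
    rcases fin3 (i := 0) (j := 1) (k := 2) (by decide) (by decide) (by decide) m with rfl | rfl | rfl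
    all_goals omega
  rcases h.plane_dich hj hjk hk0.symm (u0 := v) (v0 := u) (fun a ha e e' => hcon a ha e' e) with ⟨w, hw⟩ | ⟨w, hw⟩
  · exact lt0 _ (h.plane_sub hj hw)
  · exact lt0 _ (h.plane_sub hk0 hw)

lemma Maj.hit12 {A B : Finset (GG p)} (h : Maj A B) (h01 : p 0 < p 1) (h12 : p 1 < p 2)
    (u : ZMod (p 1)) (v : ZMod (p 2)) : ∃ a ∈ A, cl a 1 = u ∧ cl a 2 = v := by
  by_contra hcon
  push Not at hcon
  rcases h.plane_dich (i := 2) (j := 1) (k := 0) (by decide) (by decide) (by decide) (u0 := v) (v0 := u)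
    (fun a ha e e' => hcon a ha e' e) with ⟨w, hw⟩ | ⟨w, hw⟩
  · have := h.plane_sub (by decide) hw
    omega
  · obtain ⟨a, ha, e0, e1⟩ := h.hit0 h01 h12 (j := 1) (by decide) (w + 1) u
    have := hw a ha e1
    rw [e0] at this
    exact one_ne_zero (add_left_cancel (this.trans (add_zero w).symm))

lemma Maj.wt_one {A B : Finset (GG p)} (h : Maj A B) (h01 : p 0 < p 1) (h12 : p 1 < p 2) (β : CC p) :
    wt A β = 1 := by
  have hpos : ∀ β, 1 ≤ wt A β := by
    intro β
    rw [Nat.one_le_iff_ne_zero]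
    intro hw
    obtain ⟨i, hi⟩ := h.step1 hw
    have hit : ∃ a ∈ A, ∀ m, m ≠ i → cl a m = β m := by
      rcases fin3 (i := 0) (j := 1) (k := 2) (by decide) (by decide) (by decide) i with rfl | rfl | rfl
      · obtain ⟨a, ha, e1, e2⟩ := h.hit12 h01 h12 (β 1) (β 2)
        refine ⟨a, ha, fun m hm => ?_⟩
        rcases fin3 (i := 0) (j := 1) (k := 2) (by decide) (by decide) (by decide) m with rfl | rfl | rfl
        · exact absurd rfl hm
        · exact e1
        · exact e2
      · obtain ⟨a, ha, e1, e2⟩ := h.hit0 h01 h12 (j := 2) (by decide) (β 0) (β 2)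
        refine ⟨a, ha, fun m hm => ?_⟩
        rcases fin3 (i := 0) (j := 1) (k := 2) (by decide) (by decide) (by decide) m with rfl | rfl | rfl
        · exact e1
        · exact absurd rfl hm
        · exact e2
      · obtain ⟨a, ha, e1, e2⟩ := h.hit0 h01 h12 (j := 1) (by decide) (β 0) (β 1)
        refine ⟨a, ha, fun m hm => ?_⟩
        rcases fin3 (i := 0) (j := 1) (k := 2) (by decide) (by decide) (by decide) m with rfl | rfl | rfl
        · exact e1
        · exact e2
        · exact absurd rfl hm
    obtain ⟨a, ha, hm⟩ := hit
    refine absurd (hi (β i - cl a i)) (wt_pos.2 ⟨a, ha, ?_⟩)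
    funext m
    by_cases e : m = i
    · subst e; simp
    · rw [hm m e]; simp [e]
  have hsum : ∑ β : CC p, 1 = ∑ β, wt A β := by
    rw [sum_wt, h.cA, Finset.sum_const, Finset.card_univ, card_CC]; simp
  exact ((Finset.sum_eq_sum_iff_of_le (fun β _ => hpos β)).1 hsum β (mem_univ _)).symm
end five


section six
variable {p : Fin 3 → ℕ} [hp : ∀ i, Fact (p i).Prime]

/-- the line in direction `k` through `g` is multicoloured of type zero -/
def MC (f : GG p → GG p) (k : Fin 3) (g : GG p) : Prop :=
  ∃ g3 g4 : GG p, cl g3 = cl g ∧ cl g4 = cl g ∧ (∀ m, m ≠ k → g3 m = g m) ∧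
    (∀ m, m ≠ k → g4 m = g m) ∧ cl (f g3) k = 0 ∧ (g3 - f g3) k ≠ (g4 - f g4) k

lemma cl_update (g : GG p) (k : Fin 3) (c : ZMod (p k ^ 2)) (h : redp (p k) c = cl g k) :
    cl (Function.update g k c) = cl g := by
  funext m
  by_cases e : m = k
  · subst e; simp only [cl, Function.update_self]; exact h
  · simp only [cl, Function.update_of_ne e]

lemma UT.dich {A B : Finset (GG p)} (hU : UT A B) {f : GG p → GG p} (h1 : ∀ g, f g ∈ B)
    (h2 : ∀ g, g - f g ∈ A)
    (h4 : ∀ g g', cl g = cl g' → g ≠ g' → ∃ m, g m ≠ g' m ∧ cl (f g) m = cl (f g') m)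
    {k : Fin 3} {g g' : GG p} (hc : cl g = cl g') (hk : ∀ m, m ≠ k → g m = g' m) :
    (g - f g) k = (g' - f g') k ∨ f g k = f g' k := by
  have e1 := one_mv h4 hc k hk
  by_contra hcon
  push Not at hcon
  obtain ⟨na, nb⟩ := hcon
  obtain ⟨d, hd⟩ := (cl_eq_at (f g') (f g) k).1 e1.symm
  obtain ⟨c, hcc⟩ := (cl_eq_at (g - f g) (g' - f g') k).1 (by
    rw [cl_sub, cl_sub, hc]; simp [e1])
  have hd0 : d ≠ 0 := by
    rintro rfl; apply nb; rw [hd, embp_zero, add_zero]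
  have hc0 : c ≠ 0 := by
    rintro rfl; apply na; rw [hcc, embp_zero, add_zero]
  obtain ⟨v, hv⟩ := redp_surj (p := p k) (c / d)
  have hvu : IsUnit v := by rw [isUnit_iff_redp, hv]; exact div_ne_zero hc0 hd0
  have hu : IsUnit (Function.update (1 : GG p) k v) := by
    rw [Pi.isUnit_iff]
    intro m
    by_cases e : m = k
    · subst e; simpa using hvu
    · rw [Function.update_of_ne e]; exact isUnit_one
  have := (hU _ hu).2 _ (h2 g) _ (h2 g') _ (h1 g) _ (h1 g') (by
    funext m
    by_cases e : m = k
    · subst e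
      have e3 : embp (p m) c = v * embp (p m) d := by
        rw [← embp_mul, hv, div_mul_cancel₀ _ hd0]
      rw [Pi.add_apply, Pi.add_apply, Pi.mul_apply, Pi.mul_apply, Function.update_self, hcc, hd, e3]
      ring
    · rw [Pi.add_apply, Pi.add_apply, Pi.mul_apply, Pi.mul_apply, Function.update_of_ne e]
      simp [hk m e])
  exact na (by rw [this.1])

lemma UT.allcolors {A B : Finset (GG p)} (hU : UT A B) {f : GG p → GG p} (h1 : ∀ g, f g ∈ B)
    (h2 : ∀ g, g - f g ∈ A)
    (h4 : ∀ g g', cl g = cl g' → g ≠ g' → ∃ m, g m ≠ g' m ∧ cl (f g) m = cl (f g') m)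
    {k : Fin 3} {g : GG p} (hM : MC f k g) (c : ZMod (p k ^ 2)) (hcc : redp (p k) c = cl g k) :
    ∃ g', cl g' = cl g ∧ (∀ m, m ≠ k → g' m = g m) ∧ cl (f g') k = 0 ∧ (g' - f g') k = c := by
  obtain ⟨g3, g4, c3, c4, m3, m4, z, hne⟩ := hM
  have hcu : cl (Function.update g k (c + f g3 k)) = cl g := by
    apply cl_update
    rw [map_add, hcc]
    show cl g k + cl (f g3) k = _
    rw [z, add_zero]
  have hmu : ∀ m, m ≠ k → (Function.update g k (c + f g3 k)) m = g m := fun m hm =>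
    Function.update_of_ne hm _ _
  set g' := Function.update g k (c + f g3 k) with hg'
  have hz := one_mv h4 (hcu.trans c3.symm) k (fun m hm => (hmu m hm).trans (m3 m hm).symm)
  refine ⟨g', hcu, hmu, hz.trans z, ?_⟩
  have hb34 := (hU.dich h1 h2 h4 (c3.trans c4.symm)
    (fun m hm => (m3 m hm).trans (m4 m hm).symm)).resolve_left hne
  have d3 := hU.dich h1 h2 h4 (k := k) (g := g') (g' := g3) (hcu.trans c3.symm)
    (fun m hm => (hmu m hm).trans (m3 m hm).symm)
  have d4 := hU.dich h1 h2 h4 (k := k) (g := g') (g' := g4) (hcu.trans c4.symm)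
    (fun m hm => (hmu m hm).trans (m4 m hm).symm)
  have : f g' k = f g3 k := by
    rcases d3 with d3 | d3
    · rcases d4 with d4 | d4
      · exact absurd (d3.symm.trans d4) hne
      · rw [d4, hb34]
    · exact d3
  rw [Pi.sub_apply, this, hg', Function.update_self]; ring

lemma Maj.prop {A B : Finset (GG p)} (h : Maj A B) {α : CC p → GG p}
    (hα : ∀ a ∈ A, a = α (cl a)) {f : GG p → GG p} (h1 : ∀ g, f g ∈ B)
    (h2 : ∀ g, g - f g ∈ A)
    (h4 : ∀ g g', cl g = cl g' → g ≠ g' → ∃ m, g m ≠ g' m ∧ cl (f g) m = cl (f g') m)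
    {i j k : Fin 3} (hij : i ≠ j) (hik : i ≠ k) (hjk : j ≠ k) {β : CC p} {c : ZMod (p k ^ 2)}
    (hcc : redp (p k) c = β k) (hmiss : ∀ y, α (β - Pi.single j y) k ≠ c)
    {g g2 : GG p} (hg : cl g = β) (hg2 : cl g2 = β) (hj : g2 j = g j) (hM : MC f k g) :
    MC f k g2 := by
  have fa : ∀ g, cl g = β → g - f g = α (β - cl (f g)) := by
    intro g hg
    rw [hα _ (h2 g), cl_sub, hg]
  -- colour c forces type i
  have tyi : ∀ g, cl g = β → cl (f g) k = 0 → (g - f g) k = c → cl (f g) i ≠ 0 := by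
    intro g hg z hcol hi
    apply hmiss (cl (f g) j)
    rw [← hcol, fa g hg]
    congr 3
    funext m
    rcases fin3 hij hik hjk m with rfl | rfl | rfl
    · rw [hi, Pi.single_eq_of_ne hij]
    · simp
    · rw [z, Pi.single_eq_of_ne hjk.symm]
  -- moving in direction i
  have mvi : ∀ g g', cl g = β → cl g' = β → (∀ m, m ≠ i → g m = g' m) → cl (f g) k = 0 →
      (g - f g) k = c → (g' - f g') k = c ∧ cl (f g') k = 0 := by
    intro g g' hg hg' hm z hcol
    have t := tyi g hg z hcol
    have e := one_mv h4 (hg.trans hg'.symm) i hm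
    have t' : cl (f g') i ≠ 0 := by rw [← e]; exact t
    have e2 : cl (f g') = cl (f g) := by
      rw [h.single (h1 g) t, h.single (h1 g') t', e]
    rw [fa g' hg', e2, ← fa g hg]
    exact ⟨hcol, z⟩
  obtain ⟨g'', c'', m'', z'', col''⟩ := h.ut.allcolors h1 h2 h4 hM c (by rw [hcc, hg])
  have hu : ∀ x y : GG p, cl x = β → cl y = β → cl (Function.update x i (y i)) = β := by
    intro x y hx hy
    rw [cl_update _ _ _ (by show cl y i = cl x i; rw [hx, hy]), hx]
  have key := mvi g'' (Function.update g'' i (g2 i)) (c''.trans hg) (hu _ _ (c''.trans hg) hg2)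
    (fun m hm => (Function.update_of_ne hm _ _).symm) z'' col''
  have onl : ∀ x : GG p, (∀ m, m ≠ k → x m = g m) → ∀ m, m ≠ k →
      (Function.update x i (g2 i)) m = g2 m := by
    intro x hx m hm
    rcases fin3 hij hik hjk m with rfl | rfl | rfl
    · simp
    · rw [Function.update_of_ne hij.symm, hx _ hjk, hj]
    · exact absurd rfl hm
  by_contra hcon
  have all : ∀ x, cl x = β → (∀ m, m ≠ k → x m = g2 m) → (x - f x) k = c := by
    intro x hx hm
    by_contra hne
    apply hcon
    refine ⟨Function.update g'' i (g2 i), x, ?_, ?_, onl _ m'', hm, key.2, ?_⟩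
    · rw [hu _ _ (c''.trans hg) hg2, hg2]
    · rw [hx, hg2]
    · rw [key.1]; exact Ne.symm hne
  obtain ⟨g3, g4, c3, c4, m3, m4, z, hne⟩ := hM
  have back : ∀ x, cl x = cl g → (∀ m, m ≠ k → x m = g m) → (x - f x) k = c := by
    intro x hx hm
    have hxβ := hx.trans hg
    have e1 := all _ (hu x g2 hxβ hg2) (onl x hm)
    have z1 := one_mv h4 (g := Function.update x i (g2 i)) (g' := Function.update g'' i (g2 i))
      ((hu x g2 hxβ hg2).trans (hu g'' g2 (c''.trans hg) hg2).symm) k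
      (fun m hmk => (onl x hm m hmk).trans (onl g'' m'' m hmk).symm)
    exact (mvi _ x (hu x g2 hxβ hg2) hxβ (fun m hmi => Function.update_of_ne hmi _ _)
      (z1.trans key.2) e1).1
  exact hne (by rw [back g3 c3 m3, back g4 c4 m4])

lemma Maj.gen {A B : Finset (GG p)} (h : Maj A B) {i j k : Fin 3} (hij : i ≠ j) (hik : i ≠ k)
    (hjk : j ≠ k) {b1 b2 : GG p} (hb1 : b1 ∈ B) (hb2 : b2 ∈ B) (e : b1 k = b2 k)
    (t1 : cl b1 i ≠ cl b2 i) (t2 : cl b1 j ≠ cl b2 j) {a a' : GG p} (ha : a ∈ A) (ha' : a' ∈ A)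
    (ni : cl a i ≠ cl a' i) (nj : cl a j ≠ cl a' j) : a k ≠ a' k := by
  intro ek
  have := h.ut.key ha ha' hb1 hb2 (by
    intro m
    rcases fin3 hij hik hjk m with rfl | rfl | rfl
    · right; exact ⟨ni, t1⟩
    · right; exact ⟨nj, t2⟩
    · left; rw [Pi.add_apply, Pi.add_apply, e, ek])
  exact ni (by rw [this.1])

lemma Maj.lemZ {A B : Finset (GG p)} (h : Maj A B) {α : CC p → GG p} (hαA : ∀ β, α β ∈ A)
    (hαc : ∀ β, cl (α β) = β)
    (hα : ∀ a ∈ A, a = α (cl a)) {i j k : Fin 3} (hij : i ≠ j) (hik : i ≠ k)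
    (hjk : j ≠ k) {b1 b2 : GG p} (hb1 : b1 ∈ B) (hb2 : b2 ∈ B) (e : b1 k = b2 k)
    (t1 : cl b1 i ≠ 0) (t2 : cl b2 j ≠ 0) {β : CC p} {c c' : ZMod (p k ^ 2)}
    (hc : redp (p k) c = β k) (hc' : redp (p k) c' = β k)
    (hmiss : ∀ y, α (β - Pi.single j y) k ≠ c) (hmiss' : ∀ x, α (β - Pi.single i x) k ≠ c') :
    False := by
  obtain ⟨f, h1, h2, h3, h4⟩ := h.ut.dec
  have fa : ∀ g, cl g = β → g - f g = α (β - cl (f g)) := by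
    intro g hg
    rw [hα _ (h2 g), cl_sub, hg]
  have b1j : cl b1 j = 0 := (h.maj b1 hb1 i j hij).resolve_left t1
  have b1k : cl b1 k = 0 := (h.maj b1 hb1 i k hik).resolve_left t1
  have b2i : cl b2 i = 0 := (h.maj b2 hb2 i j hij).resolve_right t2
  obtain ⟨bz, hbz, hbzk⟩ := h.hB k
  have gb : ∀ b ∈ B, f (α (β - cl b) + b) = b := fun b hb => h3 _ (hαA _) b hb
  have gc : ∀ b, cl (α (β - cl b) + b) = β := by
    intro b; rw [cl_add, hαc, sub_add_cancel]
  set g1 := α (β - cl b1) + b1 with hg1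
  set g2 := α (β - cl b2) + b2 with hg2
  set gz := α (β - cl bz) + bz with hgz
  have hu : ∀ (m : Fin 3) (x y : GG p), cl x = β → cl y = β → cl (Function.update x m (y m)) = β := by
    intro m x y hx hy
    rw [cl_update _ _ _ (by show cl y m = cl x m; rw [hx, hy]), hx]
  have f1 : f g1 = b1 := gb b1 hb1
  have f2 : f g2 = b2 := gb b2 hb2
  have fz : f gz = bz := gb bz hbz
  have q1 : cl g1 = β := gc b1
  have q2 : cl g2 = β := gc b2
  have qz : cl gz = β := gc bz
  -- the first line
  have ty1 : cl (f (Function.update g1 i (g2 i))) = cl b1 := by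
    have e := one_mv h4 (g := Function.update g1 i (g2 i)) (g' := g1)
      ((hu i g1 g2 q1 q2).trans q1.symm) i (fun m hm => Function.update_of_ne hm _ _)
    rw [f1] at e
    rw [h.single (h1 _) (i := i) (by rw [e]; exact t1), e, ← h.single hb1 t1]
  have ty2 : cl (f (Function.update g2 j (g1 j))) = cl b2 := by
    have e := one_mv h4 (g := Function.update g2 j (g1 j)) (g' := g2)
      ((hu j g2 g1 q2 q1).trans q2.symm) j (fun m hm => Function.update_of_ne hm _ _)
    rw [f2] at e
    rw [h.single (h1 _) (i := j) (by rw [e]; exact t2), e, ← h.single hb2 t2]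
  have M0 : MC f k (Function.update g1 i (g2 i)) := by
    refine ⟨Function.update g1 i (g2 i), Function.update g2 j (g1 j), rfl, ?_, fun _ _ => rfl, ?_, ?_, ?_⟩
    · rw [hu j g2 g1 q2 q1, hu i g1 g2 q1 q2]
    · intro m hm
      rcases fin3 hij hik hjk m with rfl | rfl | rfl
      · rw [Function.update_of_ne hij, Function.update_self]
      · rw [Function.update_of_ne hij.symm, Function.update_self]
      · exact absurd rfl hm
    · rw [ty1]; exact b1k
    · rw [fa _ (hu i g1 g2 q1 q2), fa _ (hu j g2 g1 q2 q1), ty1, ty2]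
      refine h.gen hij hik hjk hb1 hb2 e (by rw [b2i]; exact t1) (by rw [b1j]; exact Ne.symm t2)
        (hαA _) (hαA _) ?_ ?_
      · rw [hαc, hαc]
        simpa [b2i] using t1
      · rw [hαc, hαc]
        simp only [Pi.sub_apply, b1j, sub_zero, ne_eq]
        intro hh
        exact t2 (by linear_combination hh)
  set g0 := Function.update g1 i (g2 i) with hg0
  have q0 : cl g0 = β := hu i g1 g2 q1 q2
  have M1 : MC f k (Function.update g0 i (gz i)) :=
    h.prop hα h1 h2 h4 hij hik hjk hc hmiss q0 (hu i g0 gz q0 qz)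
      (Function.update_of_ne hij.symm _ _) M0
  have M2 : MC f k gz :=
    h.prop hα h1 h2 h4 hij.symm hjk hik hc' hmiss' (hu i g0 gz q0 qz) qz
      (by rw [Function.update_self]) M1
  obtain ⟨g3, g4, c3, c4, m3, m4, z, hne⟩ := M2
  have := one_mv h4 c3 k m3
  rw [fz, z] at this
  exact hbzk this.symm

/-- pigeonhole: a missing colour -/
lemma miss_col {k : Fin 3} {n : ℕ} [NeZero n] (hn : n < p k) (F : ZMod n → ZMod (p k ^ 2)) (w : ZMod (p k)) :
    ∃ c, redp (p k) c = w ∧ ∀ y, F y ≠ c := by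
  obtain ⟨c0, rfl⟩ := redp_surj w
  by_contra hcon
  push Not at hcon
  choose G hG using fun t : ZMod (p k) => hcon (c0 + embp (p k) t) (by
    rw [map_add, redp_embp, add_zero])
  have inj : Function.Injective G := by
    intro s t e
    have := hG s
    rw [e, hG t] at this
    exact embp_inj (add_left_cancel this).symm
  have := Fintype.card_le_of_injective G inj
  rw [ZMod.card, ZMod.card] at this
  omega

/-- pigeonhole: injectivity -/
lemma inj_col {k : Fin 3} {T : Type} [Fintype T] (F : T → ZMod (p k ^ 2)) (w : ZMod (p k))
    (hF : ∀ y, redp (p k) (F y) = w) (hi : Function.Injective F) : Fintype.card T ≤ p k := by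
  obtain ⟨c0, rfl⟩ := redp_surj w
  have h0 : ∀ y, embp (p k) (qt (p k) (F y - c0)) = F y - c0 := fun y => embp_qt (by
    rw [map_sub, hF, sub_self])
  have := Fintype.card_le_of_injective (fun y => qt (p k) (F y - c0)) (by
    intro x y e
    have e' : qt (p k) (F x - c0) = qt (p k) (F y - c0) := e
    have := h0 x
    rw [e', h0 y] at this
    exact hi (sub_left_injective this).symm)
  rwa [ZMod.card] at this

lemma Maj.noSq {A B : Finset (GG p)} (h : Maj A B) (h01 : p 0 < p 1) (h12 : p 1 < p 2)
    {i j k : Fin 3} (hij : i ≠ j) (hik : i ≠ k) (hjk : j ≠ k) {b1 b2 : GG p} (hb1 : b1 ∈ B)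
    (hb2 : b2 ∈ B) (e : b1 k = b2 k) (n1 : cl b1 i ≠ cl b2 i) (n2 : cl b1 j ≠ cl b2 j) : False := by
  have : ∀ i, NeZero (p i) := fun i => ⟨(hp i).out.ne_zero⟩
  have hw := h.wt_one h01 h12
  choose α hαA hαc using fun β => (wt_pos (A := A) (β := β)).1 (by rw [hw]; exact one_ne_zero)
  have hα : ∀ a ∈ A, a = α (cl a) := by
    intro a ha
    have := hw (cl a)
    unfold wt at this
    rw [Finset.card_eq_one] at this
    obtain ⟨x, hx⟩ := this
    have m1 : a ∈ A.filter fun a' => cl a' = cl a := mem_filter.2 ⟨ha, rfl⟩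
    have m2 : α (cl a) ∈ A.filter fun a' => cl a' = cl a := mem_filter.2 ⟨hαA _, hαc _⟩
    rw [hx, mem_singleton] at m1 m2
    exact m1.trans m2.symm
  have gen : ∀ γ γ', γ i ≠ γ' i → γ j ≠ γ' j → α γ k ≠ α γ' k := by
    intro γ γ' e1 e2
    exact h.gen hij hik hjk hb1 hb2 e n1 n2 (hαA _) (hαA _) (by rwa [hαc, hαc]) (by rwa [hαc, hαc])
  -- normal form
  have nf : (cl b1 i ≠ 0 ∧ cl b2 j ≠ 0) ∨ (cl b2 i ≠ 0 ∧ cl b1 j ≠ 0) := by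
    by_cases z : cl b1 i = 0
    · right
      have z2 : cl b2 i ≠ 0 := by rw [z] at n1; exact Ne.symm n1
      refine ⟨z2, ?_⟩
      rw [(h.maj b2 hb2 i j hij).resolve_left z2] at n2; exact n2
    · left
      refine ⟨z, ?_⟩
      rw [(h.maj b1 hb1 i j hij).resolve_left z] at n2; exact Ne.symm n2
  have Z : ∀ (β : CC p) (c c' : ZMod (p k ^ 2)), redp (p k) c = β k → redp (p k) c' = β k →
      (∀ y, α (β - Pi.single j y) k ≠ c) → (∀ x, α (β - Pi.single i x) k ≠ c') → False := by
    intro β c c' hc hc' m m'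
    rcases nf with ⟨t1, t2⟩ | ⟨t1, t2⟩
    · exact h.lemZ hαA hαc hα hij hik hjk hb1 hb2 e t1 t2 hc hc' m m'
    · exact h.lemZ hαA hαc hα hij hik hjk hb2 hb1 e.symm t1 t2 hc hc' m m'
  have mid : p i < p k → p k < p j → False := by
    intro hik' hkj'
    have onto : ∀ β : CC p, ∀ c, redp (p k) c = β k → ∃ y, α (β - Pi.single j y) k = c := by
      intro β c hc
      by_contra hcon
      push Not at hcon
      obtain ⟨c', hc', m'⟩ := miss_col hik' (fun x => α (β - Pi.single i x) k) (β k)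
      exact Z β c c' hc hc' hcon m'
    have indep : ∀ γ γ' : CC p, γ i ≠ γ' i → γ j = γ' j → γ k = γ' k → α γ k = α γ' k := by
      intro γ γ' e1 e2 e3
      obtain ⟨y, hy⟩ := onto γ' (α γ k) (by
        show cl (α γ) k = _
        rw [hαc, e3])
      by_cases hy0 : y = 0
      · rw [← hy, hy0]; simp
      · exfalso
        refine gen γ (γ' - Pi.single j y) ?_ ?_ hy.symm
        · simpa [hij] using e1
        · simp only [Pi.sub_apply, Pi.single_eq_same, e2]
          intro hh
          exact hy0 (by linear_combination hh)
    have := inj_col (p := p) (k := k) (fun y : ZMod (p j) => α (Pi.single j y) k) 0 (by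
      intro y
      show cl (α _) k = 0
      rw [hαc, Pi.single_eq_of_ne hjk.symm]) (by
      intro y y' hyy
      by_contra hne
      have e1 : α (Pi.single j y) k = α (Pi.single j y + Pi.single i 1) k := by
        apply indep
        · simp [hij]
        · simp [hij.symm]
        · simp [hik.symm]
      refine gen (Pi.single j y + Pi.single i 1) (Pi.single j y') ?_ ?_ (e1.symm.trans hyy)
      · simp [hij]
      · simpa [hij.symm] using hne)
    rw [ZMod.card] at this
    omega
  have mid' : p j < p k → p k < p i → False := by
    intro hik' hkj'
    have onto : ∀ β : CC p, ∀ c, redp (p k) c = β k → ∃ y, α (β - Pi.single i y) k = c := by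
      intro β c hc
      by_contra hcon
      push Not at hcon
      obtain ⟨c', hc', m'⟩ := miss_col hik' (fun x => α (β - Pi.single j x) k) (β k)
      exact Z β c' c hc' hc m' hcon
    have indep : ∀ γ γ' : CC p, γ j ≠ γ' j → γ i = γ' i → γ k = γ' k → α γ k = α γ' k := by
      intro γ γ' e1 e2 e3
      obtain ⟨y, hy⟩ := onto γ' (α γ k) (by
        show cl (α γ) k = _
        rw [hαc, e3])
      by_cases hy0 : y = 0
      · rw [← hy, hy0]; simp
      · exfalso
        refine gen γ (γ' - Pi.single i y) ?_ ?_ hy.symm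
        · simp only [Pi.sub_apply, Pi.single_eq_same, e2]
          intro hh
          exact hy0 (by linear_combination hh)
        · simpa [hij.symm] using e1
    have := inj_col (p := p) (k := k) (fun y : ZMod (p i) => α (Pi.single i y) k) 0 (by
      intro y
      show cl (α _) k = 0
      rw [hαc, Pi.single_eq_of_ne hik.symm]) (by
      intro y y' hyy
      by_contra hne
      have e1 : α (Pi.single i y) k = α (Pi.single i y + Pi.single j 1) k := by
        apply indep
        · simp [hij.symm]
        · simp [hij]
        · simp [hjk.symm]
      refine gen (Pi.single i y + Pi.single j 1) (Pi.single i y') ?_ ?_ (e1.symm.trans hyy)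
      · simpa [hij] using hne
      · simp [hij.symm])
    rw [ZMod.card] at this
    omega
  -- smallest
  have low : p k < p i → p k < p j → False := by
    intro l1 l2
    have := inj_col (p := p) (k := k) (fun t : Fin (p k + 1) =>
      α (Pi.single i ((t : ℕ) : ZMod (p i)) + Pi.single j ((t : ℕ) : ZMod (p j))) k) 0 (by
      intro y
      show cl (α _) k = 0
      rw [hαc]; simp [hjk.symm, hik.symm]) (by
      intro y y' hyy
      by_contra hne
      have cast : ∀ n, p k < n → ((y : ℕ) : ZMod n) ≠ ((y' : ℕ) : ZMod n) := by
        intro n hn hh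
        rw [ZMod.natCast_eq_natCast_iff] at hh
        exact hne (Fin.ext (Nat.ModEq.eq_of_lt_of_lt hh (by omega) (by omega)))
      refine gen _ _ ?_ ?_ hyy
      · simpa [hij] using cast _ l1
      · simpa [hij.symm] using cast _ l2)
    rw [Fintype.card_fin] at this
    omega
  -- largest
  have high : p i < p k → p j < p k → False := by
    intro l1 l2
    obtain ⟨c', hc', m'⟩ := miss_col l1 (fun x => α (0 - Pi.single i x) k) 0
    obtain ⟨c, hc, m⟩ := miss_col l2 (fun x => α (0 - Pi.single j x) k) 0
    exact Z 0 c c' hc hc' m m'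
  have n1 : p i ≠ p k := fun e => hik (h.inj e)
  have n2 : p j ≠ p k := fun e => hjk (h.inj e)
  rcases lt_or_gt_of_ne n1 with l1 | l1 <;> rcases lt_or_gt_of_ne n2 with l2 | l2
  · exact high l1 l2
  · exact mid l1 l2
  · exact mid' l2 l1
  · exact low l1 l2
end six


section tij
variable {G : Type} [AddCommGroup G] [Fintype G] [DecidableEq G]

lemma tij_prime (A B : Finset G) (n : ℕ) (hn : n.Prime) (hco : n.Coprime (Fintype.card G))
    (hT : ∀ g, ∃ a ∈ A, ∃ b ∈ B, a + b = g) (hc : A.card * B.card = Fintype.card G) (g : G) :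
    ∃ a ∈ A, ∃ b ∈ B, a + n • b = g := by
  classical
  have : Fact n.Prime := ⟨hn⟩
  let R := AddMonoidAlgebra (ZMod n) G
  have hchar : CharP R n := charP_of_injective_algebraMap
    (FaithfulSMul.algebraMap_injective (ZMod n) R) n
  let PA : R := ∑ a ∈ A, AddMonoidAlgebra.single a 1
  let PB : R := ∑ b ∈ B, AddMonoidAlgebra.single b 1
  let U : R := ∑ g, AddMonoidAlgebra.single g 1
  have hAB : PA * PB = U := by
    show (∑ a ∈ A, AddMonoidAlgebra.single a 1 : R) * (∑ b ∈ B, AddMonoidAlgebra.single b 1 : R) = _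
    rw [Finset.sum_mul_sum, ← Finset.sum_product']
    have hsurj : ∀ g : G, ∃ x, ∃ hx : x ∈ A ×ˢ B, x.1 + x.2 = g := by
      intro g
      obtain ⟨a, ha, b, hb, e⟩ := hT g
      exact ⟨(a, b), mem_product.2 ⟨ha, hb⟩, e⟩
    have himg : (A ×ˢ B).image (fun x => x.1 + x.2) = univ := by
      ext g; simp only [mem_image, mem_univ, iff_true]
      obtain ⟨x, hx, e⟩ := hsurj g
      exact ⟨x, hx, e⟩
    have hinj : Set.InjOn (fun x : G × G => x.1 + x.2) (A ×ˢ B : Finset (G × G)) := by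
      apply Finset.card_image_iff.1
      rw [himg, Finset.card_univ, Finset.card_product, hc]
    show _ = ∑ g, (AddMonoidAlgebra.single g 1 : R)
    rw [← himg, Finset.sum_image hinj]
    refine Finset.sum_congr rfl fun x _ => ?_
    rw [AddMonoidAlgebra.single_mul_single, one_mul]
  have hUb : U * PB = B.card • U := by
    show U * ∑ b ∈ B, _ = _
    rw [Finset.mul_sum, ← Finset.sum_const]
    refine Finset.sum_congr rfl fun b _ => ?_
    show (∑ g, AddMonoidAlgebra.single g 1 : R) * _ = ∑ g, (AddMonoidAlgebra.single g 1 : R)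
    rw [Finset.sum_mul, ← Equiv.sum_comp (Equiv.addRight b) (fun g => (AddMonoidAlgebra.single g 1 : R))]
    refine Finset.sum_congr rfl fun x _ => ?_
    rw [AddMonoidAlgebra.single_mul_single, one_mul]; rfl
  have hUp : ∀ m, U * PB ^ m = (B.card ^ m) • U := by
    intro m
    induction m with
    | zero => simp
    | succ m ih => rw [pow_succ, ← mul_assoc, ih, smul_mul_assoc, hUb, smul_smul, pow_succ]
  have hfrob : PB ^ n = ∑ b ∈ B, (AddMonoidAlgebra.single (n • b) 1 : R) := by
    show (∑ b ∈ B, AddMonoidAlgebra.single b 1 : R) ^ n = _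
    rw [sum_pow_char]
    refine Finset.sum_congr rfl fun b _ => ?_
    rw [AddMonoidAlgebra.single_pow, one_pow]
  have hmain : PA * PB ^ n = (B.card ^ (n - 1)) • U := by
    obtain ⟨m, rfl⟩ : ∃ m, n = m + 1 := ⟨n - 1, by have := hn.pos; omega⟩
    rw [pow_succ', ← mul_assoc, hAB, hUp]; rfl
  by_contra hcon
  push Not at hcon
  have e := congrArg (fun x : R => x.coeff g) hmain
  have l : (PA * PB ^ n).coeff g = 0 := by
    rw [hfrob]
    show ((∑ a ∈ A, AddMonoidAlgebra.single a 1 : R) * _).coeff g = 0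
    rw [Finset.sum_mul_sum, ← Finset.sum_product', AddMonoidAlgebra.coeff_sum, Finsupp.finsetSum_apply]
    refine Finset.sum_eq_zero fun x hx => ?_
    rw [AddMonoidAlgebra.single_mul_single, AddMonoidAlgebra.coeff_single, Finsupp.single_apply,
      if_neg (hcon _ (mem_product.1 hx).1 _ (mem_product.1 hx).2)]
  have r : ((B.card ^ (n - 1)) • U).coeff g = (B.card : ZMod n) ^ (n - 1) := by
    have u : U.coeff g = 1 := by
      show (∑ g, AddMonoidAlgebra.single g 1 : R).coeff g = 1
      rw [AddMonoidAlgebra.coeff_sum, Finsupp.finsetSum_apply]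
      simp [Finsupp.single_apply]
    rw [AddMonoidAlgebra.coeff_smul_apply, u]
    simp
  simp only [l, r] at e
  have e2 : (B.card : ZMod n) = 0 := eq_zero_of_pow_eq_zero e.symm
  rw [ZMod.natCast_eq_zero_iff] at e2
  have e3 : n ∣ Fintype.card G := hc ▸ Dvd.dvd.mul_left e2 _
  exact hn.one_lt.ne' (Nat.Coprime.eq_one_of_dvd hco e3)

lemma tij_nat (A : Finset G) (n : ℕ) : ∀ (B : Finset G), n.Coprime (Fintype.card G) → n ≠ 0 →
    (∀ g, ∃ a ∈ A, ∃ b ∈ B, a + b = g) → A.card * B.card = Fintype.card G →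
    ∀ g, ∃ a ∈ A, ∃ b ∈ B, a + n • b = g := by
  induction n using Nat.recOnMul with
  | zero => intro B _ h; exact absurd rfl h
  | one => intro B _ _ hT _ g; simpa using hT g
  | prime q hq => intro B hco _ hT hc g; exact tij_prime A B q hq hco hT hc g
  | mul x y hx hy =>
    intro B hco hne hT hc g
    have hx' : x.Coprime (Fintype.card G) := Nat.Coprime.coprime_mul_right hco
    have hy' : y.Coprime (Fintype.card G) := Nat.Coprime.coprime_mul_left hco
    have hx0 : x ≠ 0 := by rintro rfl; simp at hne
    have hy0 : y ≠ 0 := by rintro rfl; simp at hne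
    have e1 := hx B hx' hx0 hT hc
    have hle : (B.image (fun b => x • b)).card ≤ B.card := Finset.card_image_le
    have hT' : ∀ g, ∃ a ∈ A, ∃ b ∈ B.image (fun b => x • b), a + b = g := by
      intro g
      obtain ⟨a, ha, b, hb, e⟩ := e1 g
      exact ⟨a, ha, x • b, mem_image_of_mem _ hb, e⟩
    have hge : Fintype.card G ≤ A.card * (B.image (fun b => x • b)).card := by
      rw [← Finset.card_product, ← Finset.card_univ]
      refine (Finset.card_le_card (t := (A ×ˢ B.image (fun b => x • b)).image (fun z => z.1 + z.2)) ?_).trans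
        Finset.card_image_le
      intro g _
      obtain ⟨a, ha, b, hb, e⟩ := hT' g
      exact mem_image.2 ⟨(a, b), mem_product.2 ⟨ha, hb⟩, e⟩
    have hc' : A.card * (B.image (fun b => x • b)).card = Fintype.card G :=
      le_antisymm (hc ▸ Nat.mul_le_mul_left _ hle) hge
    obtain ⟨a, ha, b, hb, e⟩ := hy _ hy' hy0 hT' hc' g
    obtain ⟨b', hb', rfl⟩ := mem_image.1 hb
    exact ⟨a, ha, b', hb', by rw [← e, smul_smul, mul_comm]⟩

lemma uniq_of_surj (A : Finset G) (B : Finset G) (φ : G → G)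
    (hT : ∀ g, ∃ a ∈ A, ∃ b ∈ B, a + φ b = g) (hc : A.card * B.card = Fintype.card G) :
    ∀ a ∈ A, ∀ a' ∈ A, ∀ b ∈ B, ∀ b' ∈ B, a + φ b = a' + φ b' → a = a' ∧ b = b' := by
  have himg : (A ×ˢ B).image (fun x => x.1 + φ x.2) = univ := by
    ext g; simp only [mem_image, mem_univ, iff_true]
    obtain ⟨a, ha, b, hb, e⟩ := hT g
    exact ⟨(a, b), mem_product.2 ⟨ha, hb⟩, e⟩
  have hinj : Set.InjOn (fun x : G × G => x.1 + φ x.2) (A ×ˢ B : Finset (G × G)) := by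
    apply Finset.card_image_iff.1
    rw [himg, Finset.card_univ, Finset.card_product, hc]
  intro a ha a' ha' b hb b' hb' e
  have := hinj (x₁ := (a, b)) (x₂ := (a', b')) (by simp [ha, hb]) (by simp [ha', hb']) e
  exact Prod.mk.inj this
end tij




section eight
variable {P : Fin 3 → ℕ} [hP : ∀ i, Fact (P i).Prime]

lemma gcd_prime_k (hinj : Function.Injective P) {i j k : Fin 3} (hij : i ≠ j) (hik : i ≠ k)
    (hjk : j ≠ k) {n : ℕ} (ni : ¬ P i ∣ n) (nj : ¬ P j ∣ n) (hk : P k ∣ n) (hk2 : ¬ P k ^ 2 ∣ n) :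
    Nat.gcd n (∏ m, P m ^ 2) = P k := by
  have hM : (∏ m, P m ^ 2) = P i ^ 2 * P j ^ 2 * P k ^ 2 := by
    have : (univ : Finset (Fin 3)) = {i, j, k} := by
      ext m; simpa using fin3 hij hik hjk m
    rw [this, Finset.prod_insert (by simp [hij, hik]), Finset.prod_insert (by simp [hjk]),
      Finset.prod_singleton, mul_assoc]
  set d := Nat.gcd n (∏ m, P m ^ 2) with hd
  have dn : d ∣ n := Nat.gcd_dvd_left _ _
  have dM : d ∣ P i ^ 2 * P j ^ 2 * P k ^ 2 := hM ▸ Nat.gcd_dvd_right _ _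
  have ci : Nat.Coprime d (P i ^ 2) := by
    apply Nat.Coprime.pow_right
    rw [Nat.coprime_comm, (hP i).out.coprime_iff_not_dvd]
    exact fun h => ni (h.trans dn)
  have cj : Nat.Coprime d (P j ^ 2) := by
    apply Nat.Coprime.pow_right
    rw [Nat.coprime_comm, (hP j).out.coprime_iff_not_dvd]
    exact fun h => nj (h.trans dn)
  have dk : d ∣ P k ^ 2 := (Nat.Coprime.mul_right ci cj).dvd_of_dvd_mul_left dM
  obtain ⟨e, he, hde⟩ := (Nat.dvd_prime_pow (hP k).out).1 dk
  have kd : P k ∣ d := Nat.dvd_gcd hk (hM ▸ (dvd_pow_self _ two_ne_zero).mul_left _)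
  interval_cases e
  · rw [hde, pow_zero, Nat.dvd_one] at kd
    exact absurd kd (hP k).out.ne_one
  · rw [hde, pow_one]
  · exact absurd (hde ▸ dn) hk2

lemma gcd_sq_k (hinj : Function.Injective P) {k : Fin 3} {n : ℕ}
    (h : Nat.gcd n (∏ m, P m ^ 2) = P k ^ 2) :
    P k ^ 2 ∣ n ∧ ∀ i, i ≠ k → ¬ P i ∣ n := by
  refine ⟨h ▸ Nat.gcd_dvd_left _ _, fun i hi hd => ?_⟩
  have : P i ∣ P k ^ 2 := by
    rw [← h]
    exact Nat.dvd_gcd hd ((dvd_pow_self _ two_ne_zero).trans (Finset.dvd_prod_of_mem _ (mem_univ i)))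
  exact hi (hinj ((Nat.prime_dvd_prime_iff_eq (hP i).out (hP k).out).1 ((hP i).out.dvd_of_dvd_pow this)))

lemma gcd_ne_one {n : ℕ} (h : Nat.gcd n (∏ m, P m ^ 2) ≠ 1) : ∃ i, P i ∣ n := by
  obtain ⟨q, hq, hd⟩ := Nat.exists_prime_and_dvd h
  have h1 := hd.trans (Nat.gcd_dvd_right _ _)
  obtain ⟨i, _, hi⟩ := (Prime.dvd_finsetProd_iff hq.prime _).1 h1
  refine ⟨i, ?_⟩
  rw [← (Nat.prime_dvd_prime_iff_eq hq (hP i).out).1 (hq.dvd_of_dvd_pow hi)]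
  exact hd.trans (Nat.gcd_dvd_left _ _)

theorem main17 (h01 : P 0 < P 1) (h12 : P 1 < P 2)
    (A B : Finset (ZMod (∏ m, P m ^ 2))) (hT : Tiles A B)
    (hA : A.card = NN P) (hB : B.card = NN P) (h0A : 0 ∈ A) (h0B : 0 ∈ B)
    (hApr : NotInProperSubgroup A) (hBpr : NotInProperSubgroup B) (hone : 1 ∉ DivSet B) (k : Fin 3) :
    P k ∈ DivSet B ∧ P k ^ 2 ∉ DivSet B := by
  classical
  have hinj : Function.Injective P := by
    intro i j e
    fin_cases i <;> fin_cases j <;> simp at e ⊢ <;> omega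
  have hM1 : 1 < ∏ m, P m ^ 2 := by
    have : P 0 ∣ ∏ m, P m ^ 2 := (dvd_pow_self _ two_ne_zero).trans (Finset.dvd_prod_of_mem _ (mem_univ 0))
    have hpos : 0 < ∏ m, P m ^ 2 := Finset.prod_pos fun i _ => pow_pos (hP i).out.pos 2
    exact (hP 0).out.one_lt.trans_le (Nat.le_of_dvd hpos this)
  have : NeZero (∏ m, P m ^ 2) := ⟨by omega⟩
  have cop : Pairwise (Function.onFun Nat.Coprime fun m => P m ^ 2) := by
    intro i j hij
    exact Nat.Coprime.pow _ _ ((Nat.coprime_primes (hP i).out (hP j).out).2 (fun e => hij (hinj e)))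
  let φ : ZMod (∏ m, P m ^ 2) ≃+* GG P := ZMod.prodEquivPi (fun m => P m ^ 2) cop
  have φv : ∀ x i, φ x i = ((x.val : ℕ) : ZMod (P i ^ 2)) := by
    intro x i
    conv_lhs => rw [← ZMod.natCast_zmod_val x]
    rw [map_natCast]; rfl
  have φ0 : ∀ x i, φ x i = 0 ↔ P i ^ 2 ∣ x.val := by
    intro x i; rw [φv, ZMod.natCast_eq_zero_iff]
  have φc : ∀ x i, cl (φ x) i = 0 ↔ P i ∣ x.val := by
    intro x i
    show redp (P i) (φ x i) = 0 ↔ _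
    rw [φv, redp_natCast, ZMod.natCast_eq_zero_iff]
  have hNN : NN P * NN P = ∏ m, P m ^ 2 := by
    unfold NN; rw [← Finset.prod_mul_distrib]; exact Finset.prod_congr rfl fun _ _ => (sq _).symm
  have hT' : ∀ g, ∃ a ∈ A, ∃ b ∈ B, a + b = g := by
    intro g
    obtain ⟨ab, ⟨h1, h2, h3⟩, _⟩ := hT g
    exact ⟨_, h1, _, h2, h3⟩
  have hcard : A.card * B.card = Fintype.card (ZMod (∏ m, P m ^ 2)) := by
    rw [ZMod.card, hA, hB, hNN]
  have hU : UT (A.image φ) (B.image φ) := by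
    intro u hu
    obtain ⟨w, rfl⟩ := φ.surjective u
    have hw : IsUnit w := by
      have := hu.map φ.symm
      simpa using this
    have hco : w.val.Coprime (∏ m, P m ^ 2) := by
      rw [← ZMod.isUnit_iff_coprime, ZMod.natCast_zmod_val]; exact hw
    have hne : w.val ≠ 0 := by
      intro e
      rw [e, Nat.coprime_zero_left] at hco
      omega
    have hs := tij_nat A w.val B (by rw [ZMod.card]; exact hco) hne hT' hcard
    have hsm : ∀ b : ZMod (∏ m, P m ^ 2), w.val • b = w * b := by
      intro b; rw [nsmul_eq_mul, ZMod.natCast_zmod_val]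
    simp only [hsm] at hs
    constructor
    · intro g
      obtain ⟨g, rfl⟩ := φ.surjective g
      obtain ⟨a, ha, b, hb, e⟩ := hs g
      exact ⟨φ a, mem_image_of_mem _ ha, φ b, mem_image_of_mem _ hb, by
        rw [← map_mul, ← map_add, e]⟩
    · intro a ha a' ha' b hb b' hb' e
      obtain ⟨a0, ha0, rfl⟩ := mem_image.1 ha
      obtain ⟨a1, ha1, rfl⟩ := mem_image.1 ha'
      obtain ⟨b0, hb0, rfl⟩ := mem_image.1 hb
      obtain ⟨b1, hb1, rfl⟩ := mem_image.1 hb'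
      rw [← map_mul, ← map_add, ← map_mul, ← map_add] at e
      obtain ⟨r1, r2⟩ := uniq_of_surj A B (fun b => w * b) hs hcard a0 ha0 a1 ha1 b0 hb0 b1 hb1
        (φ.injective e)
      exact ⟨by rw [r1], by rw [r2]⟩
  have nc : ∀ E : Finset (ZMod (∏ m, P m ^ 2)), 0 ∈ E → NotInProperSubgroup E →
      ∀ i, ∃ b ∈ E.image φ, ∃ b' ∈ E.image φ, cl b i ≠ cl b' i := by
    intro E h0 hE i
    obtain ⟨x, hx, hd⟩ := hE (P i)
      ((dvd_pow_self _ two_ne_zero).trans (Finset.dvd_prod_of_mem _ (mem_univ i))) (hP i).out.one_lt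
    refine ⟨φ x, mem_image_of_mem _ hx, φ 0, mem_image_of_mem _ h0, ?_⟩
    rw [(φc 0 i).2 (by simp)]
    exact fun e => hd ((φc x i).1 e)
  have φs : ∀ x y i, cl (φ (x - y)) i = 0 ↔ cl (φ x) i = cl (φ y) i := by
    intro x y i
    rw [map_sub, cl_sub, Pi.sub_apply, sub_eq_zero]
  obtain ⟨c, hm⟩ := exists_maj hinj hU
    (by rw [Finset.card_image_of_injective _ φ.injective, hA])
    (by rw [Finset.card_image_of_injective _ φ.injective, hB])
    (by
      intro b hb b' hb'
      obtain ⟨b0, hb0, rfl⟩ := mem_image.1 hb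
      obtain ⟨b1, hb1, rfl⟩ := mem_image.1 hb'
      have : Nat.gcd (b0 - b1).val (∏ m, P m ^ 2) ≠ 1 := fun e => hone ⟨b0, hb0, b1, hb1, e⟩
      obtain ⟨i, hi⟩ := gcd_ne_one this
      exact ⟨i, (φs b0 b1 i).1 ((φc _ i).2 hi)⟩)
    (nc B h0B hBpr) (nc A h0A hApr)
  obtain ⟨i, j, hij, hik, hjk⟩ : ∃ i j : Fin 3, i ≠ j ∧ i ≠ k ∧ j ≠ k := by
    clear hm; revert k; decide
  have nosq : ∀ b ∈ B, ∀ b' ∈ B, P k ^ 2 ∣ (b - b').val → ¬ P i ∣ (b - b').val →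
      ¬ P j ∣ (b - b').val → False := by
    intro b hb b' hb' e ni nj
    refine hm.noSq h01 h12 hij hik hjk (b1 := φ b - c) (b2 := φ b' - c)
      (mem_trS.2 ⟨_, mem_image_of_mem _ hb, rfl⟩) (mem_trS.2 ⟨_, mem_image_of_mem _ hb', rfl⟩) ?_ ?_ ?_
    · rw [← φ0, map_sub, Pi.sub_apply, sub_eq_zero] at e
      rw [Pi.sub_apply, Pi.sub_apply, e]
    · rw [← φc, φs] at ni
      rw [cl_sub, cl_sub]; exact fun e => ni (sub_left_injective e)
    · rw [← φc, φs] at nj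
      rw [cl_sub, cl_sub]; exact fun e => nj (sub_left_injective e)
  constructor
  · obtain ⟨b1, hb1, t1⟩ := hm.hB i
    obtain ⟨b2, hb2, t2⟩ := hm.hB j
    have b1j := (hm.maj b1 hb1 i j hij).resolve_left t1
    have b1k := (hm.maj b1 hb1 i k hik).resolve_left t1
    have b2i := (hm.maj b2 hb2 i j hij).resolve_right t2
    have b2k := (hm.maj b2 hb2 j k hjk).resolve_left t2
    obtain ⟨x1, hx1, rfl⟩ := mem_trS.1 hb1
    obtain ⟨x2, hx2, rfl⟩ := mem_trS.1 hb2
    obtain ⟨y1, hy1, rfl⟩ := mem_image.1 hx1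
    obtain ⟨y2, hy2, rfl⟩ := mem_image.1 hx2
    rw [cl_sub, Pi.sub_apply] at t1 t2 b1j b1k b2i b2k
    have ni : ¬ P i ∣ (y1 - y2).val := by
      rw [← φc, φs]; intro e; exact t1 (by rw [e, b2i])
    have nj : ¬ P j ∣ (y1 - y2).val := by
      rw [← φc, φs]; intro e; exact t2 (by rw [← e, b1j])
    have hk : P k ∣ (y1 - y2).val := by
      rw [← φc, φs]; linear_combination b1k - b2k
    exact ⟨y1, hy1, y2, hy2, gcd_prime_k hinj hij hik hjk ni nj hk
      (fun e => nosq y1 hy1 y2 hy2 e ni nj)⟩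
  · rintro ⟨b, hb, b', hb', e⟩
    obtain ⟨g1, g2⟩ := gcd_sq_k hinj e
    exact nosq b hb b' hb' g1 (g2 i hik) (g2 j hjk)
end eight

/-- Proposition 2.9(ii): `p, q, r ∈ Div(B)` and `p², q², r² ∉ Div(B)`. -/
theorem stmt_17 (p q r M : ℕ) (hp : p.Prime) (hq : q.Prime) (hr : r.Prime)
    (hpq : p < q) (hqr : q < r) (hM : M = p ^ 2 * q ^ 2 * r ^ 2)
    (A B : Finset (ZMod M)) (hT : Tiles A B)
    (hA : A.card = p * q * r) (hB : B.card = p * q * r)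
    (h0A : (0 : ZMod M) ∈ A) (h0B : (0 : ZMod M) ∈ B)
    (hApr : NotInProperSubgroup A) (hBpr : NotInProperSubgroup B)
    (hone : 1 ∉ DivSet B) :
    (p ∈ DivSet B ∧ q ∈ DivSet B ∧ r ∈ DivSet B) ∧
    (p ^ 2 ∉ DivSet B ∧ q ^ 2 ∉ DivSet B ∧ r ^ 2 ∉ DivSet B) := by
  have hP : ∀ i, Fact ((![p, q, r] : Fin 3 → ℕ) i).Prime := by
    intro i; fin_cases i
    · exact ⟨hp⟩
    · exact ⟨hq⟩
    · exact ⟨hr⟩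
  have hM' : M = ∏ m, (![p, q, r] : Fin 3 → ℕ) m ^ 2 := by
    rw [hM, Fin.prod_univ_three]; rfl
  have hN : NN ![p, q, r] = p * q * r := by
    unfold NN; rw [Fin.prod_univ_three]; rfl
  subst hM'
  have key := main17 (P := ![p, q, r]) hpq hqr A B hT (hA.trans hN.symm) (hB.trans hN.symm)
    h0A h0B hApr hBpr hone
  exact ⟨⟨(key 0).1, (key 1).1, (key 2).1⟩, (key 0).2, (key 1).2, (key 2).2⟩
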